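/- arXiv:1504.03814 — 4 statements merged into one kernel-verified Lean document; each statement's English description precedes it below -/
import Mathlib

section
/- Let {p_m}_{m≥1} and p be probability density functions on ℝ such that: (C1) there exists M ∈ (0,∞) with p_m(y) ≤ M and p(y) ≤ M for all y ∈ ℝ and all m ≥ 1; (C2) there exists a non-negative, non-decreasing function l : [0,∞) → [0,∞) that is super-logarithmic and a finite L > 0 such that ∫ l(|y|) p_m(y) dy ≤ L for all m and ∫ l(|y|) p(y) dy ≤ L. If p_m(y) → p(y) for Lebesgue-almost every y ∈ ℝ, then the differential entropies converge: h(p_m) → h(p). -/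
open MeasureTheory Real Filter Topology

/-- The differential entropy `h(p) = -∫ p ln p` of a density `p` on `ℝ`
(with the convention `0 ln 0 = 0`, which holds since `Real.log 0 = 0`). -/
noncomputable def diffEntropy (p : ℝ → ℝ) : ℝ := -∫ y, p y * Real.log (p y)

/-- `p` is a probability density function on `ℝ`. -/
def IsPDF (p : ℝ → ℝ) : Prop :=
  Measurable p ∧ (∀ y, 0 ≤ p y) ∧ (∫ y, p y) = 1

/-- `l = ω(ln)`: for every `κ > 0` there is `c > 0` with `l x ≥ κ ln x` for all `x ≥ c`. -/
def SuperLog (l : ℝ → ℝ) : Prop :=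
  ∀ κ : ℝ, 0 < κ → ∃ c : ℝ, 0 < c ∧ ∀ x : ℝ, c ≤ x → κ * Real.log x ≤ l x

lemma ec_pointwise (M : ℝ) (l : ℝ → ℝ) (hl : ∀ x : ℝ, 0 ≤ x → 0 ≤ l x)
    (hs : SuperLog l) (ε : ℝ) (hε : 0 < ε) :
    ∃ R : ℝ, 1 ≤ R ∧ ∀ q : ℝ, 0 ≤ q → q ≤ M → ∀ y : ℝ, R ≤ |y| →
      |q * Real.log q| ≤ ε * (l |y| * q) + ε * (4 * (1 + y ^ 2)⁻¹) := by
  obtain ⟨c, hc, hcl⟩ := hs (8 / ε) (by positivity)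
  refine ⟨max (max 1 (1 / ε)) (max M c), le_trans (le_max_left _ _) (le_max_left _ _), ?_⟩
  intro q hq0 hqM y hy
  simp only [max_le_iff] at hy
  obtain ⟨⟨h1, h2⟩, h3, h4⟩ := hy
  have hl0 : 0 ≤ l |y| := hl _ (abs_nonneg y)
  have hy2 : y ^ 2 = |y| ^ 2 := (sq_abs y).symm
  rw [hy2]
  generalize |y| = t at *
  have ht : 0 < t := by linarith
  have hA : 0 ≤ ε * (l t * q) := by positivity
  have hB : 0 ≤ ε * (4 * (1 + t ^ 2)⁻¹) := by positivity
  by_cases hq : q ≤ (t ^ 8)⁻¹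
  · rcases hq0.eq_or_lt with h | hqpos
    · rw [← h] at hA ⊢; simp at hA ⊢; positivity
    have hs0 : 0 < √q := Real.sqrt_pos.2 hqpos
    have hst : √q ≤ (t ^ 4)⁻¹ := by
      rw [Real.sqrt_le_left (by positivity)]
      calc q ≤ (t ^ 8)⁻¹ := hq
        _ = _ := by rw [← inv_pow]; ring
    have ht4 : 1 ≤ t ^ 4 := one_le_pow₀ h1
    have hs1 : √q ≤ 1 := hst.trans (inv_le_one_of_one_le₀ ht4)
    have hlt := Real.abs_log_mul_self_lt (√q) hs0 hs1
    have e : q * Real.log q = 2 * √q * (Real.log (√q) * √q) := by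
      rw [Real.log_sqrt hq0]
      nth_rewrite 1 [← Real.mul_self_sqrt hq0]; ring
    rw [e, abs_mul, abs_of_pos (by positivity : 0 < 2 * √q)]
    have k1 : 2 * √q * |Real.log (√q) * √q| ≤ 2 * (t ^ 4)⁻¹ := by
      calc _ ≤ 2 * √q * 1 := by gcongr
        _ ≤ _ := by linarith
    have k2 : 2 * (t ^ 4)⁻¹ ≤ ε * (4 * (1 + t ^ 2)⁻¹) := by
      have : 1 ≤ ε * t := by
        rw [div_le_iff₀ hε] at h2; linarith
      have h5 : 1 ≤ ε * t ^ 2 := by nlinarith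
      have : 1 ≤ t ^ 2 := one_le_pow₀ h1
      rw [← div_eq_mul_inv, ← div_eq_mul_inv, ← mul_div_assoc, div_le_div_iff₀ (by positivity) (by positivity)]
      nlinarith [mul_le_mul_of_nonneg_right h5 (by positivity : 0 ≤ t ^ 2)]
    linarith
  · push Not at hq
    have hqpos : 0 < q := lt_trans (by positivity) hq
    have hlog0 : 0 ≤ Real.log t := Real.log_nonneg h1
    have hu : Real.log q ≤ Real.log t := Real.log_le_log hqpos (by linarith)
    have hlow : -(8 * Real.log t) ≤ Real.log q := by
      have := Real.log_le_log (by positivity) hq.le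
      rw [Real.log_inv, Real.log_pow] at this
      exact_mod_cast this
    have hab : |Real.log q| ≤ 8 * Real.log t := abs_le.2 ⟨hlow, by linarith⟩
    have hk : 8 * Real.log t ≤ ε * l t := by
      have := hcl t h4
      rw [div_mul_eq_mul_div, div_le_iff₀ hε] at this
      linarith
    rw [abs_mul, abs_of_pos hqpos]
    have : q * |Real.log q| ≤ q * (ε * l t) := by gcongr; linarith
    nlinarith

lemma ec_tail (M : ℝ) (l : ℝ → ℝ) (L : ℝ) (hL : 0 < L) (ε : ℝ) (hε : 0 < ε) (R : ℝ)
    (hR : ∀ q : ℝ, 0 ≤ q → q ≤ M → ∀ y : ℝ, R ≤ |y| →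
      |q * Real.log q| ≤ ε * (l |y| * q) + ε * (4 * (1 + y ^ 2)⁻¹))
    (q : ℝ → ℝ) (hq0 : ∀ y, 0 ≤ q y) (hqM : ∀ y, q y ≤ M)
    (hmom : ∫⁻ y, ENNReal.ofReal (l |y| * q y) ≤ ENNReal.ofReal L) :
    ∫⁻ y in (Set.Icc (-R) R)ᶜ, ‖q y * Real.log (q y)‖ₑ
      ≤ ENNReal.ofReal (ε * (L + ∫ y : ℝ, 4 * (1 + y ^ 2)⁻¹)) := by
  have hint : Integrable (fun y : ℝ => 4 * (1 + y ^ 2)⁻¹) := integrable_inv_one_add_sq.const_mul 4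
  have hI : 0 ≤ ∫ y : ℝ, 4 * (1 + y ^ 2)⁻¹ := integral_nonneg fun y => by positivity
  calc ∫⁻ y in (Set.Icc (-R) R)ᶜ, ‖q y * Real.log (q y)‖ₑ
      ≤ ∫⁻ y in (Set.Icc (-R) R)ᶜ, (ENNReal.ofReal ε * ENNReal.ofReal (l |y| * q y)
          + ENNReal.ofReal ε * ENNReal.ofReal (4 * (1 + y ^ 2)⁻¹)) := by
        refine setLIntegral_mono' measurableSet_Icc.compl fun y hy => ?_
        have hy' : R ≤ |y| := by
          by_contra h
          exact hy (abs_le.1 (not_le.1 h).le)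
        rw [← ENNReal.ofReal_mul hε.le, ← ENNReal.ofReal_mul hε.le, Real.enorm_eq_ofReal_abs]
        exact (ENNReal.ofReal_le_ofReal (hR _ (hq0 y) (hqM y) y hy')).trans ENNReal.ofReal_add_le
    _ ≤ ∫⁻ y, (ENNReal.ofReal ε * ENNReal.ofReal (l |y| * q y)
          + ENNReal.ofReal ε * ENNReal.ofReal (4 * (1 + y ^ 2)⁻¹)) := setLIntegral_le_lintegral _ _
    _ = ENNReal.ofReal ε * (∫⁻ y, ENNReal.ofReal (l |y| * q y))
          + ENNReal.ofReal ε * ∫⁻ y : ℝ, ENNReal.ofReal (4 * (1 + y ^ 2)⁻¹) := by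
        rw [lintegral_add_right _ (by fun_prop), lintegral_const_mul' _ _ ENNReal.ofReal_ne_top,
          lintegral_const_mul' _ _ ENNReal.ofReal_ne_top]
    _ ≤ ENNReal.ofReal ε * ENNReal.ofReal L
          + ENNReal.ofReal ε * ENNReal.ofReal (∫ y : ℝ, 4 * (1 + y ^ 2)⁻¹) := by
        rw [← ofReal_integral_eq_lintegral_ofReal hint (ae_of_all _ fun y => by positivity)]
        gcongr
    _ = _ := by
        rw [← mul_add, ← ENNReal.ofReal_add hL.le hI, ← ENNReal.ofReal_mul hε.le]

lemma ec_bdd (M : ℝ) : ∃ K : ℝ, ∀ q : ℝ, 0 ≤ q → q ≤ M → ‖q * Real.log q‖ ≤ K := by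
  obtain ⟨K, hK⟩ := (isCompact_Icc (a := (0 : ℝ)) (b := M)).exists_bound_of_continuousOn
    Real.continuous_mul_log.continuousOn
  exact ⟨K, fun q h0 h1 => hK q ⟨h0, h1⟩⟩


/-- If the densities `p_m, p` are uniformly bounded (C1) and have a
uniformly bounded super-logarithmic moment (C2), then Lebesgue-almost-everywhere
pointwise convergence `p_m → p` implies convergence of the differential entropies `h(p_m) → h(p)`. -/
theorem entropy_convergence_of_ae_pointwise
    (p : ℝ → ℝ) (pm : ℕ → ℝ → ℝ)
    (hp : IsPDF p) (hpm : ∀ m : ℕ, 1 ≤ m → IsPDF (pm m))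
    (M : ℝ) (hM : 0 < M)
    (hbp : ∀ y : ℝ, p y ≤ M) (hbpm : ∀ m : ℕ, 1 ≤ m → ∀ y : ℝ, pm m y ≤ M)
    (l : ℝ → ℝ) (hl_nonneg : ∀ x : ℝ, 0 ≤ x → 0 ≤ l x)
    (hl_mono : MonotoneOn l (Set.Ici 0)) (hl_super : SuperLog l)
    (L : ℝ) (hL : 0 < L)
    (hmom : ∫⁻ y, ENNReal.ofReal (l |y| * p y) ≤ ENNReal.ofReal L)
    (hmomm : ∀ m : ℕ, 1 ≤ m → ∫⁻ y, ENNReal.ofReal (l |y| * pm m y) ≤ ENNReal.ofReal L)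
    (hconv : ∀ᵐ y : ℝ ∂(volume : Measure ℝ), Tendsto (fun m => pm m y) atTop (𝓝 (p y))) :
    Tendsto (fun m => diffEntropy (pm m)) atTop (𝓝 (diffEntropy p)) := by
  obtain ⟨K, hK⟩ := ec_bdd M
  set C : ℝ := L + ∫ y : ℝ, 4 * (1 + y ^ 2)⁻¹ with hC
  have hI : 0 ≤ ∫ y : ℝ, 4 * (1 + y ^ 2)⁻¹ := integral_nonneg fun y => by positivity
  have hCpos : 0 < C := by linarith
  rw [Metric.tendsto_atTop]
  intro δ hδ
  have hε : 0 < δ / (4 * C) := by positivity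
  obtain ⟨R, hR1, hR⟩ := ec_pointwise M l hl_nonneg hl_super _ hε
  have key : ∀ q : ℝ → ℝ, Measurable q → (∀ y, 0 ≤ q y) → (∀ y, q y ≤ M) →
      (∫⁻ y, ENNReal.ofReal (l |y| * q y) ≤ ENNReal.ofReal L) →
      |(∫ y, q y * Real.log (q y)) - ∫ y in Set.Icc (-R) R, q y * Real.log (q y)| ≤ δ / 4 := by
    intro q hq hq0 hqM hmq
    have ht := ec_tail M l L hL _ hε R hR q hq0 hqM hmq
    have e : δ / (4 * C) * (L + ∫ y : ℝ, 4 * (1 + y ^ 2)⁻¹) = δ / 4 := by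
      rw [← hC]; field_simp
    rw [e] at ht
    have hmeas : Measurable fun y => q y * Real.log (q y) := hq.mul hq.log
    have i1 : IntegrableOn (fun y => q y * Real.log (q y)) (Set.Icc (-R) R) :=
      Measure.integrableOn_of_bounded (M := K) (by simp) hmeas.aestronglyMeasurable
        (ae_of_all _ fun y => hK _ (hq0 y) (hqM y))
    have i2 : IntegrableOn (fun y => q y * Real.log (q y)) (Set.Icc (-R) R)ᶜ :=
      ⟨hmeas.aestronglyMeasurable, lt_of_le_of_lt ht ENNReal.ofReal_lt_top⟩
    have i : Integrable (fun y => q y * Real.log (q y)) := by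
      rw [← integrableOn_univ, ← Set.union_compl_self (Set.Icc (-R) R)]
      exact i1.union i2
    rw [← integral_add_compl measurableSet_Icc i, add_sub_cancel_left]
    have h1 := enorm_integral_le_lintegral_enorm (μ := volume.restrict (Set.Icc (-R) R)ᶜ)
      (fun y => q y * Real.log (q y))
    have h2 := h1.trans ht
    rw [Real.enorm_eq_ofReal_abs] at h2
    exact (ENNReal.ofReal_le_ofReal_iff (by positivity)).1 h2
  have hB : Tendsto (fun m => ∫ y in Set.Icc (-R) R, pm m y * Real.log (pm m y)) atTop
      (𝓝 (∫ y in Set.Icc (-R) R, p y * Real.log (p y))) := by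
    refine tendsto_integral_filter_of_dominated_convergence (fun _ => K) ?_ ?_ ?_ ?_
    · filter_upwards [eventually_ge_atTop 1] with m hm
      exact ((hpm m hm).1.mul (hpm m hm).1.log).aestronglyMeasurable
    · filter_upwards [eventually_ge_atTop 1] with m hm
      exact ae_of_all _ fun y => hK _ ((hpm m hm).2.1 y) (hbpm m hm y)
    · exact integrable_const _
    · filter_upwards [ae_restrict_of_ae hconv] with y hy
      exact (Real.continuous_mul_log.tendsto (p y)).comp hy
  obtain ⟨N, hN⟩ := Metric.tendsto_atTop.1 hB (δ / 4) (by positivity)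
  refine ⟨max N 1, fun m hm => ?_⟩
  have hm1 : 1 ≤ m := (le_max_right _ _).trans hm
  have a1 := hN m ((le_max_left _ _).trans hm)
  have a2 := key p hp.1 hp.2.1 hbp hmom
  have a3 := key (pm m) (hpm m hm1).1 (hpm m hm1).2.1 (hbpm m hm1) (hmomm m hm1)
  rw [Real.dist_eq] at a1 ⊢
  unfold diffEntropy
  rw [abs_lt] at a1 ⊢
  rw [abs_le] at a2 a3
  constructor <;> linarith [a1.1, a1.2, a2.1, a2.2, a3.1, a3.2]
end

section
/- Consider the channel Y = f(X) + N with input cost function C and cost bound A > 0, and suppose assumptions A1–A8 hold. Then the capacity C = sup_{F ∈ P_A} I(F) is finite, and the supremum is achieved: there exists F* ∈ P_A with I(F*) = sup_{F ∈ P_A} I(F) < ∞. -/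
open MeasureTheory Real Filter Topology

/-- Output density `p(y;F) = ∫ p_N (y - f x) dF(x)` of the channel `Y = f(X) + N`. -/
noncomputable def outputDensity (pN f : ℝ → ℝ) (F : Measure ℝ) (y : ℝ) : ℝ :=
  ∫ x, pN (y - f x) ∂F

/-- Mutual information
`I(F) = ∬ p_N(y - f x) ln [p_N(y - f x) / p(y;F)] dy dF(x)` of the channel `Y = f(X)+N`. -/
noncomputable def mutualInfo (pN f : ℝ → ℝ) (F : Measure ℝ) : ℝ :=
  ∫ x, (∫ y, pN (y - f x) *
      Real.log (pN (y - f x) / outputDensity pN f F y)) ∂F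

/-- The constraint set `P_A` of probability distributions `F` on `ℝ` with
`∫ C(|x|) dF(x) ≤ A` (integral of the non-negative cost taken in `[0,∞]`),
as a subset of the space of probability measures with the topology of
weak convergence. -/
def PA (C : ℝ → ℝ) (A : ℝ) : Set (ProbabilityMeasure ℝ) :=
  {F | ∫⁻ x, ENNReal.ofReal (C |x|) ∂(F : Measure ℝ) ≤ ENNReal.ofReal A}

-- quick instance/elaboration checks

namespace CapAux

/-- the elementary lower bound behind the entropy estimates -/
lemma G_nonneg (a t : ℝ) (ht : 0 ≤ t) : 0 ≤ a * t + Real.exp (-a - 1) + t * Real.log t := by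
  rcases ht.eq_or_lt with rfl | h
  · simp; positivity
  · have h1 := Real.add_one_le_exp (-a - 1 - Real.log t)
    have h2 : Real.exp (-a - 1) = t * Real.exp (-a - 1 - Real.log t) := by
      rw [Real.exp_sub (-a-1), Real.exp_log h]; field_simp
    rw [h2]
    nlinarith

lemma log_add (u v : ℝ) : Real.log (1 + |u + v|) ≤ Real.log (1 + |u|) + Real.log (1 + |v|) := by
  rw [← Real.log_mul (by positivity) (by positivity)]
  apply Real.log_le_log (by positivity)
  have := abs_add_le u v
  nlinarith [abs_nonneg u, abs_nonneg v]

lemma log1_nonneg (u : ℝ) : 0 ≤ Real.log (1 + |u|) :=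
  Real.log_nonneg (by linarith [abs_nonneg u])

lemma log1_cont : Continuous (fun u : ℝ => Real.log (1 + |u|)) :=
  Continuous.log (by fun_prop) (fun u => by positivity)

noncomputable def bfun (y : ℝ) : ℝ := Real.exp (-(2 * Real.log (1 + |y|)) - 1)

lemma bfun_cont : Continuous bfun := by
  have := log1_cont
  unfold bfun; fun_prop

lemma bfun_int : Integrable bfun := by
  have h := (integrable_one_add_norm (E := ℝ) (μ := volume) (r := 2) (by simp)).const_mul
    (Real.exp (-1))
  refine h.congr (Eventually.of_forall fun y => ?_)
  simp only [bfun, Real.norm_eq_abs]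
  rw [sub_eq_add_neg, Real.exp_add, mul_comm, Real.rpow_def_of_pos (by positivity)]
  congr 2; ring

/-- entropy integrability -/
lemma ent_int (r : ℝ → ℝ) (hm : Measurable r) (h0 : ∀ y, 0 ≤ r y) (h1 : ∀ y, r y ≤ 1)
    (hl : Integrable (fun y => Real.log (1 + |y|) * r y)) :
    Integrable (fun y => r y * Real.log (r y)) := by
  refine ((hl.const_mul 2).add bfun_int).mono'
    (hm.mul (Real.measurable_log.comp hm)).aestronglyMeasurable (Eventually.of_forall fun y => ?_)
  have h := G_nonneg (2 * Real.log (1 + |y|)) (r y) (h0 y)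
  have h2 : r y * Real.log (r y) ≤ 0 :=
    mul_nonpos_of_nonneg_of_nonpos (h0 y) (Real.log_nonpos (h0 y) (h1 y))
  rw [Real.norm_of_nonpos h2]
  simp only [Pi.add_apply, bfun]
  linarith

lemma pdf_int {p : ℝ → ℝ} (hp : IsPDF p) : Integrable p := by
  by_contra h
  have := hp.2.2
  rw [integral_undef h] at this
  norm_num at this

lemma log_mom {p CN : ℝ → ℝ} (hp : IsPDF p)
    (hCN_nonneg : ∀ x : ℝ, 0 ≤ x → 0 ≤ CN x) (hCN_super : SuperLog CN)
    (hCN_mom : ∫⁻ n, ENNReal.ofReal (CN |n| * p n) < ⊤) :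
    Integrable (fun n => Real.log (1 + |n|) * p n) := by
  obtain ⟨c, hc, h⟩ := hCN_super 1 one_pos
  have key : ∀ n, Real.log (1 + |n|) ≤ (Real.log (2 + c)) + CN |n| := by
    intro n
    have hn := hCN_nonneg |n| (abs_nonneg n)
    by_cases h1 : |n| ≤ 1 + c
    · have : Real.log (1 + |n|) ≤ Real.log (2 + c) :=
        Real.log_le_log (by positivity) (by linarith)
      linarith
    · push Not at h1
      have h2 := h |n| (by linarith)
      have : Real.log (1 + |n|) ≤ Real.log ((2 + c) * |n|) :=
        Real.log_le_log (by positivity) (by nlinarith)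
      rw [Real.log_mul (by positivity) (by linarith)] at this
      linarith
  refine ⟨(log1_cont.measurable.mul hp.1).aestronglyMeasurable, ?_⟩
  rw [hasFiniteIntegral_iff_ofReal (Eventually.of_forall fun n =>
    mul_nonneg (log1_nonneg n) (hp.2.1 n))]
  calc ∫⁻ n, ENNReal.ofReal (Real.log (1 + |n|) * p n)
      ≤ ∫⁻ n, (ENNReal.ofReal (Real.log (2 + c) * p n) + ENNReal.ofReal (CN |n| * p n)) := by
        apply lintegral_mono
        intro n
        simp only
        rw [← ENNReal.ofReal_add (mul_nonneg (Real.log_nonneg (by linarith)) (hp.2.1 n))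
          (mul_nonneg (hCN_nonneg _ (abs_nonneg n)) (hp.2.1 n)), ← add_mul]
        exact ENNReal.ofReal_le_ofReal (mul_le_mul_of_nonneg_right (key n) (hp.2.1 n))
    _ = (∫⁻ n, ENNReal.ofReal (Real.log (2 + c) * p n)) + ∫⁻ n, ENNReal.ofReal (CN |n| * p n) :=
        lintegral_add_left (hp.1.const_mul _).ennreal_ofReal _
    _ < ⊤ := ENNReal.add_lt_top.2 ⟨((pdf_int hp).const_mul _).lintegral_lt_top, hCN_mom⟩

section
variable {p f : ℝ → ℝ} {F : Measure ℝ} [IsProbabilityMeasure F]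

lemma sec_int (hp : IsPDF p) (h1 : ∀ n, p n ≤ 1) (hf : Continuous f) (y : ℝ) :
    Integrable (fun x => p (y - f x)) F :=
  Integrable.of_bound (C := 1) (hp.1.comp (by fun_prop)).aestronglyMeasurable
    (Eventually.of_forall fun x => by rw [Real.norm_of_nonneg (hp.2.1 _)]; exact h1 _)

lemma q_nonneg (hp : IsPDF p) (y : ℝ) : 0 ≤ outputDensity p f F y :=
  integral_nonneg fun _ => hp.2.1 _

lemma q_le_one (hp : IsPDF p) (h1 : ∀ n, p n ≤ 1) (hf : Continuous f) (y : ℝ) :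
    outputDensity p f F y ≤ 1 := by
  have := integral_mono (sec_int (F := F) hp h1 hf y) (integrable_const (1:ℝ)) (fun x => h1 _)
  simpa [outputDensity] using this

lemma q_meas (hp : IsPDF p) (hf : Continuous f) : Measurable (outputDensity p f F) := by
  have : StronglyMeasurable (fun z : ℝ × ℝ => p (z.1 - f z.2)) :=
    (hp.1.comp (by fun_prop)).stronglyMeasurable
  exact (this.integral_prod_right' (ν := F)).measurable

lemma joint_int (hp : IsPDF p) (h1 : ∀ n, p n ≤ 1) (hf : Continuous f) {g : ℝ → ℝ}
    (hg : Measurable g) (hi : Integrable (fun y => g y * outputDensity p f F y)) :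
    Integrable (fun z : ℝ × ℝ => g z.2 * p (z.2 - f z.1)) (F.prod volume) := by
  rw [integrable_prod_iff']
  · refine ⟨Eventually.of_forall fun y => (sec_int hp h1 hf y).const_mul (g y), ?_⟩
    refine hi.norm.congr (Eventually.of_forall fun y => ?_)
    simp only [norm_mul]
    rw [integral_const_mul, Real.norm_of_nonneg (q_nonneg hp y)]
    congr 1
    apply integral_congr_ae
    exact Eventually.of_forall fun x => (Real.norm_of_nonneg (hp.2.1 _)).symm
  · exact ((hg.comp measurable_snd).mul (hp.1.comp (by fun_prop))).aestronglyMeasurable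

lemma fubini {g : ℝ → ℝ}
    (hi : Integrable (fun z : ℝ × ℝ => g z.2 * p (z.2 - f z.1)) (F.prod volume)) :
    Integrable (fun y => g y * outputDensity p f F y) ∧
    ∫ x, (∫ y, g y * p (y - f x)) ∂F = ∫ y, g y * outputDensity p f F y := by
  constructor
  · refine hi.integral_prod_right.congr (Eventually.of_forall fun y => ?_)
    simp only [outputDensity, integral_const_mul]
  · rw [integral_integral_swap hi]
    simp only [outputDensity, integral_const_mul]

end

section
variable {p f : ℝ → ℝ}

lemma mi_eq {F : Measure ℝ} [IsProbabilityMeasure F]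
    (hp : IsPDF p) (h1 : ∀ n, p n ≤ 1) (hf : Continuous f)
    (hl : Integrable (fun n => Real.log (1 + |n|) * p n))
    (hq : Integrable (fun y => Real.log (1 + |y|) * outputDensity p f F y)) :
    mutualInfo p f F = (∫ n, p n * Real.log (p n)) + diffEntropy (outputDensity p f F) := by
  have hqm : Measurable (outputDensity p f F) := q_meas hp hf
  have hqe := ent_int _ hqm (q_nonneg hp) (q_le_one hp h1 hf) hq
  have hpe := ent_int p hp.1 hp.2.1 h1 hl
  have hJ : Integrable (fun z : ℝ × ℝ =>
      Real.log (outputDensity p f F z.2) * p (z.2 - f z.1)) (F.prod volume) := by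
    refine joint_int hp h1 hf (g := fun y => Real.log (outputDensity p f F y))
      (Real.measurable_log.comp hqm) ?_
    exact hqe.congr (Eventually.of_forall fun y => mul_comm _ _)
  have hzero : ∀ᵐ x ∂F, ∀ᵐ y, outputDensity p f F y = 0 → p (y - f x) = 0 := by
    rw [Measure.ae_ae_comm]
    · refine Eventually.of_forall fun y => ?_
      by_cases h : outputDensity p f F y = 0
      · have h' := (integral_eq_zero_iff_of_nonneg (fun x => hp.2.1 (y - f x))
          (sec_int hp h1 hf y)).1 h
        filter_upwards [h'] with x hx _ using hx
      · exact Eventually.of_forall fun x hh => absurd hh h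
    · have e : {z : ℝ × ℝ | outputDensity p f F z.2 = 0 → p (z.2 - f z.1) = 0} =
        {z : ℝ × ℝ | outputDensity p f F z.2 = 0}ᶜ ∪ {z : ℝ × ℝ | p (z.2 - f z.1) = 0} := by
        ext z; simp [imp_iff_not_or]
      rw [e]
      have m1 : Measurable fun z : ℝ × ℝ => outputDensity p f F z.2 := hqm.comp measurable_snd
      have m2 : Measurable fun z : ℝ × ℝ => p (z.2 - f z.1) := hp.1.comp (by fun_prop)
      exact ((m1 (measurableSet_singleton 0)).compl).union (m2 (measurableSet_singleton 0))
  have hinner : ∀ᵐ x ∂F, (∫ y, p (y - f x) * Real.log (p (y - f x) / outputDensity p f F y)) =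
      (∫ n, p n * Real.log (p n)) - ∫ y, Real.log (outputDensity p f F y) * p (y - f x) := by
    filter_upwards [hzero, hJ.prod_right_ae] with x hx hxi
    have e1 : ∫ n, p n * Real.log (p n) = ∫ y, p (y - f x) * Real.log (p (y - f x)) :=
      (integral_sub_right_eq_self (fun n => p n * Real.log (p n)) (f x)).symm
    rw [e1, ← integral_sub (hpe.comp_sub_right (f x)) hxi]
    apply integral_congr_ae
    filter_upwards [hx] with y hy
    by_cases hz : p (y - f x) = 0
    · simp [hz]
    · rw [Real.log_div hz (fun h => hz (hy h))]; ring
  have hfub := fubini (f := f) (p := p) (F := F)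
    (g := fun y => Real.log (outputDensity p f F y)) hJ
  unfold mutualInfo
  rw [integral_congr_ae hinner, integral_sub (integrable_const _) hJ.integral_prod_left,
    hfub.2]
  simp only [diffEntropy, integral_const, probReal_univ, smul_eq_mul, one_mul]
  rw [sub_eq_add_neg]
  congr 2
  exact integral_congr_ae (Eventually.of_forall fun y => mul_comm _ _)

/-- the log-moment of the output given the input -/
noncomputable def psi (p f : ℝ → ℝ) (x : ℝ) : ℝ := ∫ y, Real.log (1 + |y|) * p (y - f x)

lemma psi_eq (x : ℝ) : psi p f x = ∫ n, Real.log (1 + |f x + n|) * p n := by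
  have := integral_sub_right_eq_self (μ := volume)
    (fun n => Real.log (1 + |f x + n|) * p n) (f x)
  rw [← this]
  simp [psi]

lemma psi_dom (hp : IsPDF p) (u n : ℝ) : ‖Real.log (1 + |u + n|) * p n‖ ≤
    Real.log (1 + |u|) * p n + Real.log (1 + |n|) * p n := by
  rw [Real.norm_of_nonneg (mul_nonneg (log1_nonneg _) (hp.2.1 n)), ← add_mul]
  exact mul_le_mul_of_nonneg_right (log_add u n) (hp.2.1 n)

lemma psi_meas (hp : IsPDF p) (u : ℝ) :
    AEStronglyMeasurable (fun n => Real.log (1 + |u + n|) * p n) volume :=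
  ((log1_cont.measurable.comp (measurable_const.add measurable_id)).mul
    hp.1).aestronglyMeasurable

lemma psi_inner_int (hp : IsPDF p) (hl : Integrable (fun n => Real.log (1 + |n|) * p n)) (u : ℝ) :
    Integrable (fun n => Real.log (1 + |u + n|) * p n) :=
  (((pdf_int hp).const_mul _).add hl).mono' (psi_meas hp u)
    (Eventually.of_forall fun n => psi_dom hp u n)

lemma psi_nonneg (hp : IsPDF p) (x : ℝ) : 0 ≤ psi p f x :=
  integral_nonneg fun _ => mul_nonneg (log1_nonneg _) (hp.2.1 _)

lemma psi_le (hp : IsPDF p) (hl : Integrable (fun n => Real.log (1 + |n|) * p n)) (x : ℝ) :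
    psi p f x ≤ Real.log (1 + |f x|) + ∫ n, Real.log (1 + |n|) * p n := by
  have e : Real.log (1 + |f x|) + ∫ n, Real.log (1 + |n|) * p n =
      ∫ n, (Real.log (1 + |f x|) * p n + Real.log (1 + |n|) * p n) := by
    rw [integral_add ((pdf_int hp).const_mul _) hl, integral_const_mul, hp.2.2, mul_one]
  rw [psi_eq, e]
  exact integral_mono (psi_inner_int hp hl _) (((pdf_int hp).const_mul _).add hl)
    (fun n => (le_abs_self _).trans (psi_dom hp _ n))

lemma psi_cont (hp : IsPDF p) (hl : Integrable (fun n => Real.log (1 + |n|) * p n))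
    (hf : Continuous f) : Continuous (psi p f) := by
  have e : psi p f = fun x => ∫ n, Real.log (1 + |f x + n|) * p n := funext psi_eq
  rw [e, continuous_iff_continuousAt]
  intro x0
  have hc : Continuous fun x => Real.log (1 + |f x|) := log1_cont.comp hf
  have hev : ∀ᶠ x in 𝓝 x0, Real.log (1 + |f x|) < Real.log (1 + |f x0|) + 1 :=
    hc.continuousAt.eventually (gt_mem_nhds (by linarith))
  refine continuousAt_of_dominated
    (bound := fun n => (Real.log (1 + |f x0|) + 1) * p n + Real.log (1 + |n|) * p n)
    (Eventually.of_forall fun x => psi_meas hp _) ?_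
    (((pdf_int hp).const_mul _).add hl) ?_
  · filter_upwards [hev] with x hx
    refine Eventually.of_forall fun n => (psi_dom hp _ n).trans ?_
    have := mul_le_mul_of_nonneg_right hx.le (hp.2.1 n)
    linarith
  · refine Eventually.of_forall fun n => Continuous.continuousAt ?_
    exact (log1_cont.comp (hf.add continuous_const)).mul continuous_const

lemma out_mom {F : Measure ℝ} [IsProbabilityMeasure F]
    (hp : IsPDF p) (hf : Continuous f)
    (hl : Integrable (fun n => Real.log (1 + |n|) * p n)) (hF : Integrable (psi p f) F) :
    Integrable (fun y => Real.log (1 + |y|) * outputDensity p f F y) ∧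
    ∫ y, Real.log (1 + |y|) * outputDensity p f F y = ∫ x, psi p f x ∂F := by
  have hJ : Integrable (fun z : ℝ × ℝ => Real.log (1 + |z.2|) * p (z.2 - f z.1))
      (F.prod volume) := by
    rw [integrable_prod_iff]
    · refine ⟨Eventually.of_forall fun x => ?_, hF.congr (Eventually.of_forall fun x => ?_)⟩
      · have := (psi_inner_int hp hl (f x)).comp_sub_right (f x)
        simpa using this
      · simp only [psi]
        apply integral_congr_ae
        exact Eventually.of_forall fun y =>
          (Real.norm_of_nonneg (mul_nonneg (log1_nonneg _) (hp.2.1 _))).symm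
    · exact ((log1_cont.measurable.comp measurable_snd).mul
        (hp.1.comp (by fun_prop))).aestronglyMeasurable
  have := fubini (f := f) (p := p) (F := F) (g := fun y => Real.log (1 + |y|)) hJ
  exact ⟨this.1, this.2.symm⟩

end

section
variable {f C : ℝ → ℝ} {A : ℝ}

lemma C_lsc (hA1 : LowerSemicontinuousOn C (Set.Ici 0)) :
    LowerSemicontinuous (fun x : ℝ => C |x|) := by
  rw [← lowerSemicontinuousOn_univ_iff]
  exact hA1.comp continuous_abs.continuousOn (fun x _ => abs_nonneg x)

lemma C_int (hA : 0 < A) (hm : Measurable (fun x : ℝ => C |x|))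
    (h0 : ∀ x : ℝ, 0 ≤ x → 0 ≤ C x) {F : ProbabilityMeasure ℝ} (hF : F ∈ PA C A) :
    Integrable (fun x => C |x|) (F : Measure ℝ) ∧ ∫ x, C |x| ∂(F : Measure ℝ) ≤ A := by
  have hF' : ∫⁻ x, ENNReal.ofReal (C |x|) ∂(F : Measure ℝ) ≤ ENNReal.ofReal A := hF
  have hi : Integrable (fun x => C |x|) (F : Measure ℝ) := by
    refine ⟨hm.aestronglyMeasurable, ?_⟩
    rw [hasFiniteIntegral_iff_ofReal (Eventually.of_forall fun x => h0 _ (abs_nonneg x))]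
    exact hF'.trans_lt ENNReal.ofReal_lt_top
  refine ⟨hi, ?_⟩
  rw [← ofReal_integral_eq_lintegral_ofReal hi
    (Eventually.of_forall fun x => h0 _ (abs_nonneg x))] at hF'
  exact (ENNReal.ofReal_le_ofReal_iff hA.le).1 hF'

lemma growth
    (hA3 : ∀ κ : ℝ, 0 < κ → ∃ c : ℝ, 0 < c ∧ ∀ x : ℝ, c ≤ |x| → κ * Real.log |f x| ≤ C |x|)
    (hA4 : Continuous f)
    (hA5_inf : Tendsto (fun x : ℝ => |f x|) (cocompact ℝ) atTop)
    (ε c0 : ℝ) (hε : 0 < ε) :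
    ∃ M, 0 ≤ M ∧ ∀ x, M < Real.log (1 + |f x|) + c0 → Real.log (1 + |f x|) + c0 ≤ ε * C |x| := by
  obtain ⟨c, hc, h⟩ := hA3 (2 / ε) (by positivity)
  have e1 : ∀ᶠ x in cocompact ℝ, max 1 (2 * Real.exp c0) ≤ |f x| :=
    hA5_inf.eventually (eventually_ge_atTop _)
  have e2 : ∀ᶠ x in cocompact ℝ, c ≤ |x| :=
    (tendsto_norm_cocompact_atTop (E := ℝ)).eventually (eventually_ge_atTop c)
  obtain ⟨t, ht, hts⟩ := mem_cocompact.1 (e1.and e2)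
  have hcont : Continuous fun x => Real.log (1 + |f x|) + c0 :=
    (log1_cont.comp hA4).add continuous_const
  obtain ⟨M, hM⟩ := ht.bddAbove_image hcont.continuousOn
  refine ⟨max M 0, le_max_right _ _, fun x hx => ?_⟩
  have hxt : x ∉ t := fun hxt => by
    have := hM ⟨x, hxt, rfl⟩
    have h2 := le_max_left M 0
    simp only at this
    linarith
  obtain ⟨h1, h2⟩ := hts hxt
  have h3 : 1 ≤ |f x| := (le_max_left _ _).trans h1
  have h4 : 2 * Real.exp c0 ≤ |f x| := (le_max_right _ _).trans h1
  have h5 := h x h2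
  have h6 : Real.log 2 + c0 ≤ Real.log |f x| := by
    have := Real.log_le_log (by positivity) h4
    rwa [Real.log_mul (by norm_num) (Real.exp_ne_zero _), Real.log_exp] at this
  have h7 : Real.log (1 + |f x|) ≤ Real.log 2 + Real.log |f x| := by
    rw [← Real.log_mul (by norm_num) (by linarith)]
    exact Real.log_le_log (by linarith) (by linarith)
  have h8 : 2 * Real.log |f x| ≤ ε * C |x| := by
    have := mul_le_mul_of_nonneg_left h5 hε.le
    calc 2 * Real.log |f x| = ε * (2 / ε * Real.log |f x|) := by field_simp
      _ ≤ _ := this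
  linarith

lemma PA_closed (hA1 : LowerSemicontinuousOn C (Set.Ici 0))
    (h0 : ∀ x : ℝ, 0 ≤ x → 0 ≤ C x) : IsClosed (PA C A) := by
  apply IsSeqClosed.isClosed
  intro u F hu hlim
  have hl := C_lsc hA1
  have hm : Measurable (fun x : ℝ => C |x|) := hl.measurable
  have hnn : ∀ μ : Measure ℝ, 0 ≤ᵐ[μ] (fun x : ℝ => C |x|) := fun μ =>
    Eventually.of_forall fun x => h0 _ (abs_nonneg x)
  have key : ∫⁻ x, ENNReal.ofReal (C |x|) ∂(F : Measure ℝ) ≤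
      atTop.liminf (fun i => ∫⁻ x, ENNReal.ofReal (C |x|) ∂(u i : Measure ℝ)) := by
    have e : ∀ μ : Measure ℝ, ∫⁻ x, ENNReal.ofReal (C |x|) ∂μ =
        ∫⁻ (t : ℝ) in Set.Ioi 0, μ {a | t < C |a|} := fun μ =>
      lintegral_eq_lintegral_meas_lt μ (hnn μ) hm.aemeasurable
    simp_rw [e]
    refine (lintegral_mono fun t => ?_).trans (lintegral_liminf_le
      (fun n ↦ Antitone.measurable (fun s t hst ↦
            measure_mono (fun ω hω ↦ lt_of_le_of_lt hst hω))))
    exact ProbabilityMeasure.le_liminf_measure_open_of_tendsto hlim (hl.isOpen_preimage t)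
  refine key.trans ?_
  calc _ ≤ atTop.liminf (fun _ : ℕ => ENNReal.ofReal A) :=
        liminf_le_liminf (Eventually.of_forall fun i => hu i)
    _ = _ := liminf_const _

lemma PA_tight (hm : Measurable (fun x : ℝ => C |x|))
    (hA3 : ∀ κ : ℝ, 0 < κ → ∃ c : ℝ, 0 < c ∧ ∀ x : ℝ, c ≤ |x| → κ * Real.log |f x| ≤ C |x|)
    (hA5_inf : Tendsto (fun x : ℝ => |f x|) (cocompact ℝ) atTop) :
    IsTightMeasureSet {((μ : ProbabilityMeasure ℝ) : Measure ℝ) | μ ∈ PA C A} := by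
  rw [isTightMeasureSet_iff_exists_isCompact_measure_compl_le]
  intro ε hε
  obtain ⟨c, hc, h⟩ := hA3 1 one_pos
  have hlog : Tendsto (fun x => Real.log |f x|) (cocompact ℝ) atTop :=
    Real.tendsto_log_atTop.comp hA5_inf
  have hne : ENNReal.ofReal A / ε ≠ ⊤ :=
    (ENNReal.div_lt_top ENNReal.ofReal_ne_top hε.ne').ne
  set R : ℝ := (ENNReal.ofReal A / ε).toReal + 1 with hR
  have e1 : ∀ᶠ x in cocompact ℝ, R ≤ Real.log |f x| := hlog.eventually (eventually_ge_atTop _)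
  have e2 : ∀ᶠ x in cocompact ℝ, c ≤ |x| :=
    (tendsto_norm_cocompact_atTop (E := ℝ)).eventually (eventually_ge_atTop c)
  obtain ⟨t, ht, hts⟩ := mem_cocompact.1 (e1.and e2)
  refine ⟨t, ht, ?_⟩
  rintro _ ⟨μ, hμ, rfl⟩
  have hR0 : 0 < R := by positivity
  have hsub : tᶜ ⊆ {x | ENNReal.ofReal R ≤ ENNReal.ofReal (C |x|)} := by
    intro x hx
    obtain ⟨h1, h2⟩ := hts hx
    have := h x h2
    exact ENNReal.ofReal_le_ofReal (by linarith)
  have hmk := mul_meas_ge_le_lintegral (μ := (μ : Measure ℝ)) hm.ennreal_ofReal (ENNReal.ofReal R)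
  have h2 : ENNReal.ofReal R * (μ : Measure ℝ) tᶜ ≤ ENNReal.ofReal A :=
    (mul_le_mul_right (measure_mono hsub) _).trans (hmk.trans hμ)
  have h3 : ENNReal.ofReal A / ε ≤ ENNReal.ofReal R := by
    rw [← ENNReal.ofReal_toReal hne]
    exact ENNReal.ofReal_le_ofReal (by linarith)
  have h4 : (μ : Measure ℝ) tᶜ ≤ ENNReal.ofReal A / ENNReal.ofReal R := by
    rw [ENNReal.le_div_iff_mul_le (Or.inl (by simpa using hR0)) (Or.inl ENNReal.ofReal_ne_top),
      mul_comm]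
    exact h2
  refine h4.trans (ENNReal.div_le_of_le_mul ?_)
  by_cases hε' : ε = ⊤
  · subst hε'
    rw [ENNReal.top_mul (by simpa using hR0)]; exact le_top
  · have := (ENNReal.div_le_iff hε.ne' hε').1 h3
    rwa [mul_comm] at this

lemma PA_compact (hA1 : LowerSemicontinuousOn C (Set.Ici 0))
    (h0 : ∀ x : ℝ, 0 ≤ x → 0 ≤ C x)
    (hA3 : ∀ κ : ℝ, 0 < κ → ∃ c : ℝ, 0 < c ∧ ∀ x : ℝ, c ≤ |x| → κ * Real.log |f x| ≤ C |x|)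
    (hA5_inf : Tendsto (fun x : ℝ => |f x|) (cocompact ℝ) atTop) : IsCompact (PA C A) := by
  have := isCompact_closure_of_isTightMeasureSet
    (PA_tight (A := A) (C_lsc hA1).measurable hA3 hA5_inf)
  rwa [(PA_closed hA1 h0).closure_eq] at this

end

section
variable {p f C : ℝ → ℝ} {A : ℝ}

lemma psi_int (hp : IsPDF p) (hl : Integrable (fun n => Real.log (1 + |n|) * p n))
    (hA : 0 < A) (hm : Measurable (fun x : ℝ => C |x|))
    (h0 : ∀ x : ℝ, 0 ≤ x → 0 ≤ C x)
    (hA3 : ∀ κ : ℝ, 0 < κ → ∃ c : ℝ, 0 < c ∧ ∀ x : ℝ, c ≤ |x| → κ * Real.log |f x| ≤ C |x|)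
    (hf : Continuous f)
    (hA5_inf : Tendsto (fun x : ℝ => |f x|) (cocompact ℝ) atTop)
    {F : ProbabilityMeasure ℝ} (hF : F ∈ PA C A) :
    Integrable (psi p f) (F : Measure ℝ) := by
  obtain ⟨M, hM0, hM⟩ := growth hA3 hf hA5_inf 1 (∫ n, Real.log (1 + |n|) * p n) one_pos
  refine ((integrable_const M).add (C_int hA hm h0 hF).1).mono'
    (psi_cont hp hl hf).aestronglyMeasurable (Eventually.of_forall fun x => ?_)
  rw [Real.norm_of_nonneg (psi_nonneg hp x)]
  have h1 := psi_le (f := f) hp hl x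
  have h2 := h0 |x| (abs_nonneg x)
  have h3 := hM x
  simp only [Pi.add_apply]
  by_cases h : M < Real.log (1 + |f x|) + ∫ n, Real.log (1 + |n|) * p n
  · linarith [h3 h]
  · linarith

lemma psi_usc (hp : IsPDF p) (hl : Integrable (fun n => Real.log (1 + |n|) * p n))
    (hA : 0 < A) (hm : Measurable (fun x : ℝ => C |x|))
    (h0 : ∀ x : ℝ, 0 ≤ x → 0 ≤ C x)
    (hA3 : ∀ κ : ℝ, 0 < κ → ∃ c : ℝ, 0 < c ∧ ∀ x : ℝ, c ≤ |x| → κ * Real.log |f x| ≤ C |x|)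
    (hf : Continuous f)
    (hA5_inf : Tendsto (fun x : ℝ => |f x|) (cocompact ℝ) atTop)
    {u : ℕ → ProbabilityMeasure ℝ} {F : ProbabilityMeasure ℝ} (hu : ∀ k, u k ∈ PA C A)
    (hF : F ∈ PA C A) (hlim : Tendsto u atTop (𝓝 F)) (ε : ℝ) (hε : 0 < ε) :
    ∀ᶠ k in atTop, ∫ x, psi p f x ∂(u k : Measure ℝ) ≤ ∫ x, psi p f x ∂(F : Measure ℝ) + ε := by
  obtain ⟨M, hM0, hM⟩ := growth hA3 hf hA5_inf (ε / (2 * A))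
    (∫ n, Real.log (1 + |n|) * p n) (by positivity)
  have hc : Continuous fun x => min (psi p f x) M := (psi_cont hp hl hf).min continuous_const
  have hb : ∀ x, ‖min (psi p f x) M‖ ≤ M := fun x => by
    rw [Real.norm_of_nonneg (le_min (psi_nonneg hp x) hM0)]; exact min_le_right _ _
  have ht := (ProbabilityMeasure.tendsto_iff_forall_integral_tendsto.1 hlim)
    (BoundedContinuousFunction.ofNormedAddCommGroup _ hc M hb)
  simp only [BoundedContinuousFunction.coe_ofNormedAddCommGroup] at ht
  have hmi : ∀ G : ProbabilityMeasure ℝ,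
      Integrable (fun x => min (psi p f x) M) (G : Measure ℝ) := fun G =>
    Integrable.of_bound (C := M) hc.aestronglyMeasurable (Eventually.of_forall hb)
  have hle : ∫ x, min (psi p f x) M ∂(F : Measure ℝ) ≤ ∫ x, psi p f x ∂(F : Measure ℝ) :=
    integral_mono (hmi F) (psi_int hp hl hA hm h0 hA3 hf hA5_inf hF) (fun x => min_le_left _ _)
  have hev := ht.eventually (gt_mem_nhds (show ∫ x, min (psi p f x) M ∂(F : Measure ℝ) <
    ∫ x, psi p f x ∂(F : Measure ℝ) + ε / 2 by linarith))
  filter_upwards [hev] with k hk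
  obtain ⟨ci, cA⟩ := C_int hA hm h0 (hu k)
  have h1 : ∫ x, psi p f x ∂(u k : Measure ℝ) ≤
      ∫ x, (min (psi p f x) M + ε / (2 * A) * C |x|) ∂(u k : Measure ℝ) := by
    refine integral_mono (psi_int hp hl hA hm h0 hA3 hf hA5_inf (hu k))
      ((hmi _).add (ci.const_mul _)) (fun x => ?_)
    have h2 := psi_le (f := f) hp hl x
    have h3 : 0 ≤ ε / (2 * A) * C |x| := mul_nonneg (by positivity) (h0 _ (abs_nonneg x))
    simp only
    by_cases h : psi p f x ≤ M
    · rw [min_eq_left h]; linarith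
    · push Not at h
      rw [min_eq_right h.le]
      linarith [hM x (by linarith)]
  rw [integral_add (hmi _) (ci.const_mul _), integral_const_mul] at h1
  have h4 : ε / (2 * A) * ∫ x, C |x| ∂(u k : Measure ℝ) ≤ ε / 2 := by
    calc _ ≤ ε / (2 * A) * A := mul_le_mul_of_nonneg_left cA (by positivity)
      _ = ε / 2 := by field_simp
  linarith

lemma ent_usc (hp : IsPDF p) (hl : Integrable (fun n => Real.log (1 + |n|) * p n))
    (hpc : Continuous p) (hp1 : ∀ n, p n ≤ 1)
    (hA : 0 < A) (hm : Measurable (fun x : ℝ => C |x|))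
    (h0 : ∀ x : ℝ, 0 ≤ x → 0 ≤ C x)
    (hA3 : ∀ κ : ℝ, 0 < κ → ∃ c : ℝ, 0 < c ∧ ∀ x : ℝ, c ≤ |x| → κ * Real.log |f x| ≤ C |x|)
    (hf : Continuous f)
    (hA5_inf : Tendsto (fun x : ℝ => |f x|) (cocompact ℝ) atTop)
    {u : ℕ → ProbabilityMeasure ℝ} {F : ProbabilityMeasure ℝ} (hu : ∀ k, u k ∈ PA C A)
    (hF : F ∈ PA C A) (hlim : Tendsto u atTop (𝓝 F)) (b : ℝ)
    (hb : ∀ k, b ≤ diffEntropy (outputDensity p f (u k : Measure ℝ))) :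
    b ≤ diffEntropy (outputDensity p f (F : Measure ℝ)) := by
  set q : ProbabilityMeasure ℝ → ℝ → ℝ := fun G => outputDensity p f (G : Measure ℝ) with hq
  let g : ProbabilityMeasure ℝ → ℝ → ℝ := fun G y =>
    2 * Real.log (1 + |y|) * q G y + bfun y + q G y * Real.log (q G y)
  have hqm : ∀ G, Measurable (q G) := fun G => q_meas hp hf
  have hgm : ∀ G, Measurable (g G) := fun G =>
    (((log1_cont.measurable.const_mul 2).mul (hqm G)).add bfun_cont.measurable).add
      ((hqm G).mul (Real.measurable_log.comp (hqm G)))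
  have hg0 : ∀ G y, 0 ≤ g G y := fun G y => G_nonneg _ _ (q_nonneg hp y)
  have hgi : ∀ G ∈ PA C A, Integrable (g G) ∧
      ∫ y, g G y = 2 * ∫ x, psi p f x ∂(G : Measure ℝ) + (∫ y, bfun y) - diffEntropy (q G) := by
    intro G hG
    obtain ⟨i1, e1⟩ := out_mom hp hf hl (psi_int hp hl hA hm h0 hA3 hf hA5_inf hG)
    have i2 := ent_int (q G) (hqm G) (q_nonneg hp) (q_le_one hp hp1 hf) i1
    have i1' : Integrable fun y => 2 * Real.log (1 + |y|) * q G y :=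
      (i1.const_mul 2).congr (Eventually.of_forall fun y => (mul_assoc _ _ _).symm)
    refine ⟨(i1'.add bfun_int).add i2, ?_⟩
    have e2 : ∫ y, 2 * Real.log (1 + |y|) * q G y = 2 * ∫ x, psi p f x ∂(G : Measure ℝ) := by
      rw [← e1, ← integral_const_mul]
      exact integral_congr_ae (Eventually.of_forall fun y => mul_assoc _ _ _)
    have e3 : ∫ y, g G y = (∫ y, 2 * Real.log (1 + |y|) * q G y) + (∫ y, bfun y) +
        ∫ y, q G y * Real.log (q G y) := by
      rw [← integral_add i1' bfun_int]
      exact integral_add (i1'.add bfun_int) i2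
    rw [e3, e2, diffEntropy]; ring
  have hqlim : ∀ y, Tendsto (fun k => q (u k) y) atTop (𝓝 (q F y)) := by
    intro y
    have hc : Continuous fun x => p (y - f x) := hpc.comp (continuous_const.sub hf)
    have ht := (ProbabilityMeasure.tendsto_iff_forall_integral_tendsto.1 hlim)
      (BoundedContinuousFunction.ofNormedAddCommGroup _ hc 1
        (fun x => by rw [Real.norm_of_nonneg (hp.2.1 _)]; exact hp1 _))
    simp only [BoundedContinuousFunction.coe_ofNormedAddCommGroup] at ht
    exact ht
  have hglim : ∀ y, Tendsto (fun k => g (u k) y) atTop (𝓝 (g F y)) := by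
    intro y
    exact (((hqlim y).const_mul _).add_const _).add
      ((Real.continuous_mul_log.tendsto _).comp (hqlim y))
  have hfatou : ∫⁻ y, ENNReal.ofReal (g F y) ≤
      atTop.liminf fun k => ∫⁻ y, ENNReal.ofReal (g (u k) y) := by
    refine le_trans (le_of_eq ?_) (lintegral_liminf_le fun k => (hgm (u k)).ennreal_ofReal)
    refine lintegral_congr fun y => ?_
    exact (((ENNReal.continuous_ofReal.tendsto _).comp (hglim y)).liminf_eq).symm
  have hconv : ∀ G ∈ PA C A, ∫⁻ y, ENNReal.ofReal (g G y) = ENNReal.ofReal (∫ y, g G y) :=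
    fun G hG => (ofReal_integral_eq_lintegral_ofReal (hgi G hG).1
      (Eventually.of_forall (hg0 G))).symm
  apply le_of_forall_pos_le_add
  intro ε hε
  have hev := psi_usc hp hl hA hm h0 hA3 hf hA5_inf hu hF hlim (ε / 2) (by linarith)
  set Z : ℝ := 2 * ∫ x, psi p f x ∂(F : Measure ℝ) + (∫ y, bfun y) - b + ε with hZ
  have hev2 : ∀ᶠ k in atTop, ∫ y, g (u k) y ≤ Z := by
    filter_upwards [hev] with k hk
    rw [(hgi _ (hu k)).2]
    have := hb k
    simp only [hZ, hq]
    linarith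
  have hZ0 : 0 ≤ Z := by
    obtain ⟨k, hk⟩ := hev2.exists
    exact (integral_nonneg (hg0 (u k))).trans hk
  have hfin : ENNReal.ofReal (∫ y, g F y) ≤ ENNReal.ofReal Z := by
    rw [← hconv F hF]
    refine hfatou.trans ?_
    calc _ ≤ atTop.liminf (fun _ : ℕ => ENNReal.ofReal Z) := by
          refine liminf_le_liminf ?_
          filter_upwards [hev2] with k hk
          rw [hconv _ (hu k)]
          exact ENNReal.ofReal_le_ofReal hk
      _ = _ := liminf_const _
  have := (ENNReal.ofReal_le_ofReal_iff hZ0).1 hfin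
  rw [(hgi F hF).2] at this
  simp only [hZ, hq] at this
  linarith

end

end CapAux


/-- Under assumptions A1–A8 the capacity of the average-cost
constrained channel `Y = f(X) + N` is finite and achievable: the mutual
information attains its (finite) supremum over `P_A` at some `F* ∈ P_A`. -/
theorem capacity_finite_achievable
    (f pN C : ℝ → ℝ) (A : ℝ) (hA : 0 < A)
    -- A1: the cost function is lower semi-continuous
    (hA1 : LowerSemicontinuousOn C (Set.Ici 0))
    -- A2: the cost function is non-decreasing (and WLOG non-negative with `C 0 = 0`)
    (hA2_mono : MonotoneOn C (Set.Ici 0)) (hA2_nonneg : ∀ x : ℝ, 0 ≤ x → 0 ≤ C x)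
    (hC0 : C 0 = 0)
    -- A3: `C(|x|) = ω(ln |f(x)|)`
    (hA3 : ∀ κ : ℝ, 0 < κ → ∃ c : ℝ, 0 < c ∧ ∀ x : ℝ, c ≤ |x| → κ * Real.log |f x| ≤ C |x|)
    -- A4: `f` is continuous
    (hA4 : Continuous f)
    -- A5: `|f(x)|` is non-decreasing in `|x|` and `|f(x)| → ∞` as `|x| → ∞`
    (hA5_mono : ∀ x z : ℝ, |x| ≤ |z| → |f x| ≤ |f z|)
    (hA5_inf : Tendsto (fun x : ℝ => |f x|) (cocompact ℝ) atTop)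
    -- A6, A7: the noise density is continuous and (WLOG) bounded by one
    (hpN : IsPDF pN) (hA6 : Continuous pN) (hA7 : ∀ n : ℝ, pN n ≤ 1)
    -- A8: finite super-logarithmic noise moment
    (CN : ℝ → ℝ) (hCN_mono : MonotoneOn CN (Set.Ici 0))
    (hCN_nonneg : ∀ x : ℝ, 0 ≤ x → 0 ≤ CN x) (hCN_super : SuperLog CN)
    (hCN_mom : ∫⁻ n, ENNReal.ofReal (CN |n| * pN n) < ⊤) :
    ∃ Fstar ∈ PA C A, ∀ F ∈ PA C A,
      mutualInfo pN f (F : Measure ℝ) ≤ mutualInfo pN f (Fstar : Measure ℝ) := by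

  have hl := CapAux.log_mom hpN hCN_nonneg hCN_super hCN_mom
  have hm : Measurable (fun x : ℝ => C |x|) := (CapAux.C_lsc hA1).measurable
  have hcomp : IsCompact (PA C A) := CapAux.PA_compact hA1 hA2_nonneg hA3 hA5_inf
  have hne : (PA C A).Nonempty := by
    refine ⟨⟨Measure.dirac 0, inferInstance⟩, ?_⟩
    change ∫⁻ x, ENNReal.ofReal (C |x|) ∂(Measure.dirac (0 : ℝ)) ≤ ENNReal.ofReal A
    rw [lintegral_dirac]
    simp [hC0]
  have husc : UpperSemicontinuousOn
      (fun F : ProbabilityMeasure ℝ => diffEntropy (outputDensity pN f (F : Measure ℝ)))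
      (PA C A) := by
    intro F hF b hb
    by_contra hcon
    have hfr : ∃ᶠ G : ProbabilityMeasure ℝ in 𝓝[PA C A] F,
        b ≤ diffEntropy (outputDensity pN f (G : Measure ℝ)) ∧ G ∈ PA C A := by
      refine Frequently.and_eventually ?_ self_mem_nhdsWithin
      rw [Filter.not_eventually] at hcon
      exact hcon.mono fun G hG => not_lt.1 hG
    obtain ⟨u, hu, hu2⟩ := exists_seq_forall_of_frequently hfr
    have := CapAux.ent_usc hpN hl hA6 hA7 hA hm hA2_nonneg hA3 hA4 hA5_inf
      (fun k => (hu2 k).2) hF (hu.mono_right nhdsWithin_le_nhds) b (fun k => (hu2 k).1)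
    exact absurd hb (not_lt.2 this)
  obtain ⟨Fs, hFs, hmax⟩ := husc.exists_isMaxOn hne hcomp
  have hmi : ∀ F ∈ PA C A, mutualInfo pN f (F : Measure ℝ) =
      (∫ n, pN n * Real.log (pN n)) + diffEntropy (outputDensity pN f (F : Measure ℝ)) :=
    fun F hF => CapAux.mi_eq hpN hA7 hA4 hl (CapAux.out_mom hpN hA4 hl
      (CapAux.psi_int hpN hl hA hm hA2_nonneg hA3 hA4 hA5_inf hF)).1
  refine ⟨Fs, hFs, fun F hF => ?_⟩
  rw [hmi F hF, hmi Fs hFs]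
  have : diffEntropy (outputDensity pN f (F : Measure ℝ)) ≤
      diffEntropy (outputDensity pN f (Fs : Measure ℝ)) := hmax hF
  linarith
end

section
/- Consider the channel Y = f(X) + N with input cost function C and cost bound A > 0, and suppose assumptions A1–A8 hold. If the map F ↦ p(·;F) taking an input distribution to its output density is injective on P_A, then the maximizer of the mutual information I over P_A is unique: there is exactly one F* ∈ P_A with I(F*) = max_{F ∈ P_A} I(F). -/
open MeasureTheory Real Filter Topology

-- quick instance/elaboration checks


section aux
variable {pN f : ℝ → ℝ}

lemma od_integrable (hf : Continuous f) (hp : Continuous pN) (h0 : ∀ y, 0 ≤ pN y)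
    (h1 : ∀ y, pN y ≤ 1) (F : Measure ℝ) [IsProbabilityMeasure F] (y : ℝ) :
    Integrable (fun x => pN (y - f x)) F := by
  refine Integrable.of_bound (C := 1) (by fun_prop) (ae_of_all _ fun x => ?_)
  rw [Real.norm_eq_abs, abs_of_nonneg (h0 _)]; exact h1 _

lemma od_nonneg (h0 : ∀ y, 0 ≤ pN y) (F : Measure ℝ) (y : ℝ) :
    0 ≤ outputDensity pN f F y := integral_nonneg fun _ => h0 _

lemma od_le_one (hf : Continuous f) (hp : Continuous pN) (h0 : ∀ y, 0 ≤ pN y)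
    (h1 : ∀ y, pN y ≤ 1) (F : Measure ℝ) [IsProbabilityMeasure F] (y : ℝ) :
    outputDensity pN f F y ≤ 1 := by
  calc outputDensity pN f F y ≤ ∫ x, (1:ℝ) ∂F :=
        integral_mono (od_integrable hf hp h0 h1 F y) (integrable_const _) fun x => h1 _
    _ = 1 := by simp

lemma od_continuous (hf : Continuous f) (hp : Continuous pN) (h0 : ∀ y, 0 ≤ pN y)
    (h1 : ∀ y, pN y ≤ 1) (F : Measure ℝ) [IsProbabilityMeasure F] :
    Continuous (outputDensity pN f F) := by
  refine continuous_of_dominated (bound := fun _ => 1) ?_ ?_ (integrable_const _) ?_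
  · intro y; exact (od_integrable hf hp h0 h1 F y).aestronglyMeasurable
  · intro y; refine ae_of_all _ fun x => ?_
    rw [Real.norm_eq_abs, abs_of_nonneg (h0 _)]; exact h1 _
  · exact ae_of_all _ fun x => by fun_prop

lemma od_lintegral (hf : Continuous f) (hp : Continuous pN) (h0 : ∀ y, 0 ≤ pN y)
    (h1 : ∀ y, pN y ≤ 1) (F : Measure ℝ) [IsProbabilityMeasure F] (φ : ℝ → ENNReal)
    (hφ : Measurable φ) :
    ∫⁻ y, ENNReal.ofReal (outputDensity pN f F y) * φ y =
      ∫⁻ x, (∫⁻ z, ENNReal.ofReal (pN z) * φ (z + f x)) ∂F := by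
  have e : ∀ y, ENNReal.ofReal (outputDensity pN f F y) * φ y =
      ∫⁻ x, ENNReal.ofReal (pN (y - f x)) * φ y ∂F := by
    intro y
    rw [lintegral_mul_const _ (by fun_prop)]
    congr 1
    exact ofReal_integral_eq_lintegral_ofReal (od_integrable hf hp h0 h1 F y)
      (ae_of_all _ fun x => h0 _)
  simp_rw [e]
  rw [lintegral_lintegral_swap (by fun_prop)]
  refine lintegral_congr fun x => ?_
  rw [← lintegral_add_right_eq_self _ (f x)]
  simp

/-- Pointwise entropy bound. -/
lemma negMulLog_bound (p y : ℝ) (hp : 0 ≤ p) :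
    negMulLog p ≤ p * Real.log (1 + y ^ 2) + (1 + y ^ 2)⁻¹ := by
  have hq : 0 < 1 + y ^ 2 := by positivity
  rcases hp.eq_or_lt with rfl | hp
  · simp; positivity
  · have := Real.log_le_sub_one_of_pos (x := (1 + y ^ 2)⁻¹ / p) (by positivity)
    rw [Real.log_div (by positivity) hp.ne', Real.log_inv] at this
    have h2 := mul_le_mul_of_nonneg_left this hp.le
    have h3 : p * ((1 + y ^ 2)⁻¹ / p - 1) = (1 + y ^ 2)⁻¹ - p := by field_simp
    rw [h3] at h2
    simp only [negMulLog]
    nlinarith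

lemma log_tail (a b R : ℝ) :
    ({y : ℝ | R < |y|}.indicator (fun y => ENNReal.ofReal (Real.log (1 + y ^ 2))) (a + b)) ≤
    {y : ℝ | R / 2 < |y|}.indicator (fun y => ENNReal.ofReal (Real.log (1 + 4 * y ^ 2))) a +
    {y : ℝ | R / 2 < |y|}.indicator (fun y => ENNReal.ofReal (Real.log (1 + 4 * y ^ 2))) b := by
  have key : ∀ u v : ℝ, |v| ≤ |u| →
    ({y : ℝ | R < |y|}.indicator (fun y => ENNReal.ofReal (Real.log (1 + y ^ 2))) (u + v)) ≤
    {y : ℝ | R / 2 < |y|}.indicator (fun y => ENNReal.ofReal (Real.log (1 + 4 * y ^ 2))) u := by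
    intro u v h
    have h2 : |u + v| ≤ 2 * |u| := (abs_add_le u v).trans (by linarith)
    by_cases hR : R < |u + v|
    · rw [Set.indicator_of_mem (by exact hR), Set.indicator_of_mem (by simp; linarith)]
      apply ENNReal.ofReal_le_ofReal
      apply Real.log_le_log (by positivity)
      have : (u + v) ^ 2 ≤ (2 * |u|) ^ 2 := by
        rw [← sq_abs (u + v)]; exact pow_le_pow_left₀ (abs_nonneg _) h2 2
      rw [mul_pow, sq_abs] at this; linarith
    · rw [Set.indicator_of_notMem (by exact hR)]; exact zero_le
  rcases le_total |a| |b| with h | h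
  · rw [add_comm a b]; exact (key b a h).trans le_add_self
  · exact (key a b h).trans le_self_add

/-- Mass of `log (1+4z^2)` against a density with a superlog moment is finite. -/
lemma log_moment (hpm : Continuous pN) (h0 : ∀ y, 0 ≤ pN y) (hint : ∫ y, pN y = 1) {CN : ℝ → ℝ}
    (hCN_nonneg : ∀ x : ℝ, 0 ≤ x → 0 ≤ CN x) (hCN_super : SuperLog CN)
    (hCN_mom : ∫⁻ n, ENNReal.ofReal (CN |n| * pN n) < ⊤) :
    ∫⁻ z, ENNReal.ofReal (pN z) * ENNReal.ofReal (Real.log (1 + 4 * z ^ 2)) < ⊤ := by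
  obtain ⟨c, hc, h⟩ := hCN_super 1 one_pos
  have hfin : ∫⁻ z, ENNReal.ofReal (pN z) = 1 := by
    rw [← ofReal_integral_eq_lintegral_ofReal, hint, ENNReal.ofReal_one]
    · by_contra hh; rw [integral_undef hh] at hint; norm_num at hint
    · exact ae_of_all _ h0
  set K := Real.log (1 + 4 * (c+1) ^ 2) + Real.log 5 with hK
  have hb : ∀ z, Real.log (1 + 4 * z ^ 2) ≤ K + 2 * CN |z| := by
    intro z
    have hC := hCN_nonneg |z| (abs_nonneg _)
    have l5 : 0 ≤ Real.log 5 := Real.log_nonneg (by norm_num)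
    have lc : 0 ≤ Real.log (1 + 4 * (c+1) ^ 2) := Real.log_nonneg (by nlinarith [sq_nonneg (c+1)])
    rcases le_total |z| (c+1) with hz | hz
    · have : Real.log (1 + 4 * z ^ 2) ≤ Real.log (1 + 4 * (c+1) ^ 2) := by
        apply Real.log_le_log (by positivity)
        have := pow_le_pow_left₀ (abs_nonneg z) hz 2
        rw [sq_abs] at this; linarith
      linarith
    · have h1 := h |z| (by linarith)
      have hz1 : 1 ≤ |z| := by linarith
      have : Real.log (1 + 4 * z ^ 2) ≤ Real.log (5 * |z| ^ 2) := by
        apply Real.log_le_log (by positivity)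
        rw [sq_abs]; have := one_le_pow₀ (n := 2) hz1; rw [sq_abs] at this; linarith
      rw [Real.log_mul (by norm_num) (by positivity), Real.log_pow] at this
      push_cast at this; linarith
  calc ∫⁻ z, ENNReal.ofReal (pN z) * ENNReal.ofReal (Real.log (1 + 4 * z ^ 2))
      ≤ ∫⁻ z, (ENNReal.ofReal K * ENNReal.ofReal (pN z) + 2 * ENNReal.ofReal (CN |z| * pN z)) := by
        refine lintegral_mono fun z => ?_
        have hC := hCN_nonneg |z| (abs_nonneg _)
        calc _ ≤ ENNReal.ofReal (pN z) * (ENNReal.ofReal K + 2 * ENNReal.ofReal (CN |z|)) := by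
              gcongr
              refine (ENNReal.ofReal_le_ofReal (hb z)).trans (ENNReal.ofReal_add_le.trans ?_)
              rw [ENNReal.ofReal_mul (by norm_num)]; simp
          _ = _ := by rw [ENNReal.ofReal_mul hC]; ring
    _ = ENNReal.ofReal K * 1 + 2 * ∫⁻ z, ENNReal.ofReal (CN |z| * pN z) := by
        rw [lintegral_add_left (by fun_prop), lintegral_const_mul _ (by fun_prop), hfin,
          lintegral_const_mul' _ _ (by simp)]
    _ < ⊤ := by
        simp only [mul_one]
        exact ENNReal.add_lt_top.2 ⟨ENNReal.ofReal_lt_top, ENNReal.mul_lt_top (by simp) hCN_mom⟩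

/-- tails of an integrable function. -/
lemma tail_tendsto (φ : ℝ → ENNReal) (hφ : Measurable φ) (h : ∫⁻ z, φ z < ⊤) {ε : ENNReal}
    (hε : 0 < ε) : ∃ R₀ : ℝ, ∀ R ≥ R₀, ∫⁻ z, {y : ℝ | R < |y|}.indicator φ z ≤ ε := by
  have : Tendsto (fun n : ℕ => ∫⁻ z, {y : ℝ | (n:ℝ) < |y|}.indicator φ z) atTop
      (𝓝 (∫⁻ z : ℝ, 0)) := by
    refine tendsto_lintegral_of_dominated_convergence φ ?_ ?_ h.ne ?_
    · intro n; exact hφ.indicator (measurableSet_lt measurable_const (by fun_prop))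
    · intro n; exact ae_of_all _ fun z => Set.indicator_le_self _ _ _
    · refine ae_of_all _ fun z => ?_
      obtain ⟨N, hN⟩ := exists_nat_gt |z|
      refine tendsto_const_nhds.congr' ?_
      filter_upwards [eventually_ge_atTop N] with n hn
      rw [Set.indicator_of_notMem]
      simp only [Set.mem_ofPred_eq, not_lt]
      exact hN.le.trans (by exact_mod_cast hn)
  rw [lintegral_zero] at this
  obtain ⟨N, hN⟩ := (this.eventually_le_const hε).exists
  refine ⟨N, fun R hR => le_trans (lintegral_mono fun z => ?_) hN⟩
  refine Set.indicator_le_indicator_of_subset (fun y hy => ?_) (fun _ => zero_le) z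
  simp only [Set.mem_ofPred_eq] at hy ⊢; linarith

/-- Uniform tail bound for the output entropy. -/
lemma entropy_tail (hf : Continuous f) (hp : Continuous pN) (h0 : ∀ y, 0 ≤ pN y)
    (h1 : ∀ y, pN y ≤ 1) (hint : ∫ y, pN y = 1) {C : ℝ → ℝ} {A : ℝ}
    (hA3 : ∀ κ : ℝ, 0 < κ → ∃ c : ℝ, 0 < c ∧ ∀ x : ℝ, c ≤ |x| → κ * Real.log |f x| ≤ C |x|)
    (hA5_mono : ∀ x z : ℝ, |x| ≤ |z| → |f x| ≤ |f z|)
    (hmom : ∫⁻ z, ENNReal.ofReal (pN z) * ENNReal.ofReal (Real.log (1 + 4 * z ^ 2)) < ⊤)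
    {ε : ENNReal} (hε : 0 < ε) :
    ∃ R : ℝ, 0 < R ∧ ∀ F : ProbabilityMeasure ℝ, F ∈ PA C A →
      ∫⁻ y, {y : ℝ | R < |y|}.indicator
        (fun y => ENNReal.ofReal (negMulLog (outputDensity pN f F y))) y ≤ ε := by
  have hfin : ∫⁻ z, ENNReal.ofReal (pN z) = 1 := by
    rw [← ofReal_integral_eq_lintegral_ofReal, hint, ENNReal.ofReal_one]
    · by_contra hh; rw [integral_undef hh] at hint; norm_num at hint
    · exact ae_of_all _ h0
  have hε3 : 0 < ε / 3 := ENNReal.div_pos hε.ne' (by simp)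
  obtain ⟨R₁, hR₁⟩ := tail_tendsto (fun z => ENNReal.ofReal ((1 + z ^ 2)⁻¹)) (by fun_prop)
    (integrable_inv_one_add_sq.lintegral_lt_top) hε3
  obtain ⟨R₂, hR₂⟩ := tail_tendsto _ (by fun_prop) hmom hε3
  -- choose κ
  obtain ⟨δ, hδ, hδε⟩ : ∃ δ : ℝ, 0 < δ ∧ ENNReal.ofReal δ * ENNReal.ofReal A ≤ ε / 3 := by
    have : Tendsto (fun δ : ℝ => ENNReal.ofReal δ * ENNReal.ofReal A) (𝓝[>] 0) (𝓝 0) := by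
      have h : Tendsto (fun δ : ℝ => ENNReal.ofReal (δ * |A|)) (𝓝[>] 0) (𝓝 (ENNReal.ofReal (0 * |A|))) := by
        apply tendsto_nhdsWithin_of_tendsto_nhds
        exact (ENNReal.continuous_ofReal.comp (by fun_prop : Continuous fun δ : ℝ => δ * |A|)).tendsto 0
      rw [zero_mul, ENNReal.ofReal_zero] at h
      refine tendsto_of_tendsto_of_tendsto_of_le_of_le' tendsto_const_nhds h
        (Eventually.of_forall fun _ => zero_le) ?_
      filter_upwards [self_mem_nhdsWithin] with d hd
      rw [ENNReal.ofReal_mul (le_of_lt hd)]; gcongr; exact le_abs_self A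
    obtain ⟨d, hd, hd0⟩ := ((this.eventually_le_const hε3).and self_mem_nhdsWithin).exists
    exact ⟨d, hd0, hd⟩
  obtain ⟨c, hc, hcc⟩ := hA3 (5 / δ) (by positivity)
  set R := max (max 1 R₁) (max (2 * R₂) (2 * (|f c| + 2))) with hR
  have hRa : R₁ ≤ R := (le_max_right _ _).trans (le_max_left _ _)
  have hRb : 2 * R₂ ≤ R := (le_max_left _ _).trans (le_max_right _ _)
  have hRc : 2 * (|f c| + 2) ≤ R := (le_max_right _ _).trans (le_max_right _ _)
  have hRd : 1 ≤ R := (le_max_left _ _).trans (le_max_left _ _)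
  refine ⟨R, by linarith, fun F hF => ?_⟩
  set S : Set ℝ := {y : ℝ | R < |y|} with hS
  set T : Set ℝ := {y : ℝ | R / 2 < |y|} with hT
  have mS : MeasurableSet S := measurableSet_lt measurable_const (by fun_prop)
  have mT : MeasurableSet T := measurableSet_lt measurable_const (by fun_prop)
  set φ : ℝ → ENNReal := S.indicator fun y => ENNReal.ofReal (Real.log (1 + y ^ 2)) with hφ
  set ψ : ℝ → ENNReal := T.indicator fun y => ENNReal.ofReal (Real.log (1 + 4 * y ^ 2)) with hψ
  have mφ : Measurable φ := Measurable.indicator (by fun_prop) mS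
  have mψ : Measurable ψ := Measurable.indicator (by fun_prop) mT
  have b1 : ∀ y, S.indicator
        (fun y => ENNReal.ofReal (negMulLog (outputDensity pN f F y))) y ≤
        ENNReal.ofReal (outputDensity pN f F y) * φ y +
        S.indicator (fun z => ENNReal.ofReal ((1 + z ^ 2)⁻¹)) y := by
    intro y
    by_cases hy : y ∈ S
    · simp only [hφ, Set.indicator_of_mem hy]
      rw [← ENNReal.ofReal_mul (od_nonneg h0 _ _)]
      exact (ENNReal.ofReal_le_ofReal (negMulLog_bound _ y (od_nonneg h0 _ _))).trans
        ENNReal.ofReal_add_le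
    · simp [Set.indicator_of_notMem hy]
  have b2 : ∀ x, ψ (f x) ≤ ENNReal.ofReal δ * ENNReal.ofReal (C |x|) := by
    intro x
    by_cases hx : f x ∈ T
    · simp only [hψ, Set.indicator_of_mem hx]
      rw [← ENNReal.ofReal_mul hδ.le]
      apply ENNReal.ofReal_le_ofReal
      have hx' : R / 2 < |f x| := hx
      have hxc : c ≤ |x| := by
        by_contra hlt
        push Not at hlt
        have := hA5_mono x c (hlt.le.trans (le_abs_self c))
        linarith
      have h2 := hcc x hxc
      have h3 : 2 ≤ |f x| := by have := abs_nonneg (f c); linarith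
      have h4 : Real.log (1 + 4 * (f x) ^ 2) ≤ 5 * Real.log |f x| := by
        have : Real.log (1 + 4 * (f x) ^ 2) ≤ Real.log (|f x| ^ 5) := by
          apply Real.log_le_log (by positivity)
          rw [← sq_abs (f x)]
          have h8 : (2:ℝ) ^ 3 ≤ |f x| ^ 3 := pow_le_pow_left₀ (by norm_num) h3 3
          have h9 : (2:ℝ) ^ 2 ≤ |f x| ^ 2 := pow_le_pow_left₀ (by norm_num) h3 2
          have : |f x| ^ 5 = |f x| ^ 3 * |f x| ^ 2 := by ring
          rw [this]; nlinarith
        rw [Real.log_pow] at this; exact_mod_cast this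
      have h5 : δ * (5 / δ * Real.log |f x|) ≤ δ * C |x| := mul_le_mul_of_nonneg_left h2 hδ.le
      have h6 : δ * (5 / δ * Real.log |f x|) = 5 * Real.log |f x| := by field_simp
      linarith
    · simp [hψ, Set.indicator_of_notMem hx]
  have b3 : ∫⁻ y, ENNReal.ofReal (outputDensity pN f F y) * φ y ≤ ε / 3 + ε / 3 := by
    rw [od_lintegral hf hp h0 h1 F φ mφ]
    have inner : ∀ x, ∫⁻ z, ENNReal.ofReal (pN z) * φ (z + f x) ≤
        ε / 3 + ENNReal.ofReal δ * ENNReal.ofReal (C |x|) := by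
      intro x
      calc ∫⁻ z, ENNReal.ofReal (pN z) * φ (z + f x)
          ≤ ∫⁻ z, (ENNReal.ofReal (pN z) * ψ z + ENNReal.ofReal (pN z) * ψ (f x)) := by
            refine lintegral_mono fun z => ?_
            rw [← mul_add]; gcongr; exact log_tail z (f x) R
        _ = (∫⁻ z, ENNReal.ofReal (pN z) * ψ z) + ψ (f x) := by
            rw [lintegral_add_left (by fun_prop), lintegral_mul_const _ (by fun_prop), hfin,
              one_mul]
        _ ≤ _ := by
            gcongr
            · refine le_trans (le_of_eq ?_) (hR₂ (R / 2) (by linarith))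
              refine lintegral_congr fun z => ?_
              by_cases hz : z ∈ T
              · rw [hψ, Set.indicator_of_mem hz, Set.indicator_of_mem hz]
              · rw [hψ, Set.indicator_of_notMem hz, Set.indicator_of_notMem hz, mul_zero]
            · exact b2 x
    calc _ ≤ ∫⁻ x, (ε / 3 + ENNReal.ofReal δ * ENNReal.ofReal (C |x|)) ∂(F : Measure ℝ) :=
          lintegral_mono inner
      _ = ε / 3 + ENNReal.ofReal δ * ∫⁻ x, ENNReal.ofReal (C |x|) ∂(F : Measure ℝ) := by
          rw [lintegral_add_left measurable_const, lintegral_const,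
            lintegral_const_mul' _ _ (by simp)]
          simp
      _ ≤ ε / 3 + ENNReal.ofReal δ * ENNReal.ofReal A := by gcongr; exact hF
      _ ≤ _ := by gcongr
  have mo : Measurable (outputDensity pN f (F : Measure ℝ)) :=
    (od_continuous hf hp h0 h1 F).measurable
  calc _ ≤ ∫⁻ y, (ENNReal.ofReal (outputDensity pN f F y) * φ y +
        S.indicator (fun z => ENNReal.ofReal ((1 + z ^ 2)⁻¹)) y) := lintegral_mono b1
    _ = (∫⁻ y, ENNReal.ofReal (outputDensity pN f F y) * φ y) +
        ∫⁻ y, S.indicator (fun z => ENNReal.ofReal ((1 + z ^ 2)⁻¹)) y :=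
        lintegral_add_left (by fun_prop) _
    _ ≤ (ε / 3 + ε / 3) + ε / 3 := by gcongr; exact hR₁ R hRa
    _ = ε := ENNReal.add_thirds ε

end aux

section aux2
variable {pN f : ℝ → ℝ}

lemma mutualInfo_eq (hf : Continuous f) (hp : Continuous pN) (h0 : ∀ y, 0 ≤ pN y)
    (h1 : ∀ y, pN y ≤ 1) (F : Measure ℝ) [IsProbabilityMeasure F]
    (hE : Integrable fun y => negMulLog (outputDensity pN f F y))
    (hN : Integrable fun y => negMulLog (pN y)) :
    mutualInfo pN f F = (∫ y, negMulLog (outputDensity pN f F y)) - ∫ y, negMulLog (pN y) := by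
  have mo : Measurable (outputDensity pN f F) := (od_continuous hf hp h0 h1 F).measurable
  set u : ℝ × ℝ → ℝ := fun q => negMulLog (pN (q.2 - f q.1)) with hu
  set v : ℝ × ℝ → ℝ := fun q => pN (q.2 - f q.1) * Real.log (outputDensity pN f F q.2) with hv
  set w : ℝ × ℝ → ℝ := fun q => pN (q.2 - f q.1) *
    Real.log (pN (q.2 - f q.1) / outputDensity pN f F q.2) with hw
  have mf : Measurable f := hf.measurable
  have mp : Measurable pN := hp.measurable
  have mu : Measurable u := by
    exact (continuous_negMulLog.comp (by fun_prop : Continuous fun q : ℝ × ℝ => pN (q.2 - f q.1))).measurable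
  have mv : Measurable v := by fun_prop
  have iu : Integrable u (F.prod volume) := by
    rw [integrable_prod_iff mu.aestronglyMeasurable]
    constructor
    · exact ae_of_all _ fun x => hN.comp_sub_right (f x)
    · have : (fun x => ∫ y, ‖u (x, y)‖) = fun _ => ∫ y, ‖negMulLog (pN y)‖ := by
        funext x
        exact integral_sub_right_eq_self (fun y => ‖negMulLog (pN y)‖) (f x)
      rw [this]; exact integrable_const _
  have iv : Integrable v (F.prod volume) := by
    rw [integrable_prod_iff' mv.aestronglyMeasurable]
    constructor
    · exact ae_of_all _ fun y =>
        (od_integrable hf hp h0 h1 F y).mul_const (Real.log (outputDensity pN f F y))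
    · have : (fun y => ∫ x, ‖v (x, y)‖ ∂F) = fun y => ‖negMulLog (outputDensity pN f F y)‖ := by
        funext y
        simp only [hv, norm_mul, negMulLog, norm_neg]
        rw [integral_mul_const]
        congr 1
        rw [Real.norm_of_nonneg (od_nonneg h0 F y)]
        exact integral_congr_ae (ae_of_all _ fun x => Real.norm_of_nonneg (h0 _))
      rw [this]; exact hE.norm
  have hae : w =ᵐ[F.prod volume] fun q => -u q - v q := by
    have ms : MeasurableSet {q : ℝ × ℝ | outputDensity pN f F q.2 = 0 → pN (q.2 - f q.1) = 0} := by
      have : {q : ℝ × ℝ | outputDensity pN f F q.2 = 0 → pN (q.2 - f q.1) = 0} =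
        {q : ℝ × ℝ | outputDensity pN f F q.2 = 0}ᶜ ∪ {q : ℝ × ℝ | pN (q.2 - f q.1) = 0} := by
        ext q; simp [imp_iff_not_or]
      rw [this]
      exact (measurableSet_eq_fun (by fun_prop) (by fun_prop)).compl.union
        (measurableSet_eq_fun (by fun_prop) (by fun_prop))
    have hz : ∀ᵐ q ∂(F.prod volume), outputDensity pN f F q.2 = 0 → pN (q.2 - f q.1) = 0 := by
      rw [Measure.ae_prod_iff_ae_ae ms]
      rw [Measure.ae_ae_comm (p := fun x y => outputDensity pN f F y = 0 → pN (y - f x) = 0) ms]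
      refine ae_of_all _ fun y => ?_
      by_cases hy : outputDensity pN f F y = 0
      · have := (integral_eq_zero_iff_of_nonneg (fun x => h0 (y - f x))
          (od_integrable hf hp h0 h1 F y)).1 hy
        filter_upwards [this] with x hx _ using hx
      · exact ae_of_all _ fun x h => absurd h hy
    filter_upwards [hz] with q hq
    simp only [hw, hu, hv, negMulLog]
    by_cases hpq : pN (q.2 - f q.1) = 0
    · simp [hpq]
    · rw [Real.log_div hpq (fun h => hpq (hq h))]; ring
  have iw : Integrable w (F.prod volume) := (iu.neg.sub iv).congr hae.symm
  calc mutualInfo pN f F = ∫ q, w q ∂(F.prod volume) := (integral_prod w iw).symm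
    _ = ∫ q, (-u q - v q) ∂(F.prod volume) := integral_congr_ae hae
    _ = -(∫ q, u q ∂(F.prod volume)) - ∫ q, v q ∂(F.prod volume) := by
        rw [← integral_neg]; exact integral_sub iu.neg iv
    _ = -(∫ y, negMulLog (pN y)) + ∫ y, negMulLog (outputDensity pN f F y) := by
        have e1 : ∫ q, u q ∂(F.prod volume) = ∫ y, negMulLog (pN y) := by
          rw [integral_prod u iu]
          have : (fun x => ∫ y, u (x, y)) = fun _ => ∫ y, negMulLog (pN y) := by
            funext x
            exact integral_sub_right_eq_self (fun y => negMulLog (pN y)) (f x)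
          rw [this]; simp
        have e2 : ∫ q, v q ∂(F.prod volume) = -∫ y, negMulLog (outputDensity pN f F y) := by
          rw [integral_prod_symm v iv, ← integral_neg]
          refine integral_congr_ae (ae_of_all _ fun y => ?_)
          simp only [hv, negMulLog]
          rw [integral_mul_const]
          simp [outputDensity]
        rw [e1, e2]; ring
    _ = _ := by ring

lemma PA_isClosed {C : ℝ → ℝ} {A : ℝ}
    (hA1 : LowerSemicontinuousOn C (Set.Ici 0)) (hA2_nonneg : ∀ x : ℝ, 0 ≤ x → 0 ≤ C x) :
    IsClosed (PA C A) := by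
  have hl : LowerSemicontinuous fun x : ℝ => C |x| := by
    intro x t ht
    have h := hA1 |x| (abs_nonneg x) t ht
    have hc : Tendsto (fun x : ℝ => |x|) (𝓝 x) (𝓝[Set.Ici 0] |x|) :=
      tendsto_nhdsWithin_iff.2 ⟨continuous_abs.tendsto x, Eventually.of_forall fun y => abs_nonneg y⟩
    exact hc.eventually h
  have hm : Measurable fun x : ℝ => C |x| := hl.measurable
  have lc : ∀ F : ProbabilityMeasure ℝ, ∫⁻ x, ENNReal.ofReal (C |x|) ∂(F : Measure ℝ) =
      ∫⁻ t in Set.Ioi (0:ℝ), (F : Measure ℝ) {x | t < C |x|} := fun F =>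
    lintegral_eq_lintegral_meas_lt _ (ae_of_all _ fun x => hA2_nonneg _ (abs_nonneg x)) hm.aemeasurable
  apply IsSeqClosed.isClosed
  intro Fn F hFn hlim
  show ∫⁻ x, ENNReal.ofReal (C |x|) ∂(F : Measure ℝ) ≤ ENNReal.ofReal A
  rw [lc]
  calc ∫⁻ t in Set.Ioi (0:ℝ), (F : Measure ℝ) {x | t < C |x|}
      ≤ ∫⁻ t in Set.Ioi (0:ℝ), liminf (fun n => (Fn n : Measure ℝ) {x | t < C |x|}) atTop :=
        lintegral_mono fun t =>
          ProbabilityMeasure.le_liminf_measure_open_of_tendsto hlim (hl.isOpen_preimage t)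
    _ ≤ liminf (fun n => ∫⁻ t in Set.Ioi (0:ℝ), (Fn n : Measure ℝ) {x | t < C |x|}) atTop := by
        refine lintegral_liminf_le fun n => Antitone.measurable ?_
        intro s t hst
        exact measure_mono fun x (hx : t < C |x|) => hst.trans_lt hx
    _ ≤ ENNReal.ofReal A := by
        refine liminf_le_of_frequently_le' (Frequently.of_forall fun n => ?_)
        rw [← lc]; exact hFn n

lemma PA_tight {C : ℝ → ℝ} {A : ℝ}
    (hA1 : LowerSemicontinuousOn C (Set.Ici 0)) 
    (hA3 : ∀ κ : ℝ, 0 < κ → ∃ c : ℝ, 0 < c ∧ ∀ x : ℝ, c ≤ |x| → κ * Real.log |f x| ≤ C |x|)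
    (hA5_inf : Tendsto (fun x : ℝ => |f x|) (cocompact ℝ) atTop) :
    IsTightMeasureSet {x : Measure ℝ | ∃ μ ∈ PA C A, (μ : Measure ℝ) = x} := by
  have hl : LowerSemicontinuous fun x : ℝ => C |x| := by
    intro x t ht
    have h := hA1 |x| (abs_nonneg x) t ht
    have hc : Tendsto (fun x : ℝ => |x|) (𝓝 x) (𝓝[Set.Ici 0] |x|) :=
      tendsto_nhdsWithin_iff.2 ⟨continuous_abs.tendsto x, Eventually.of_forall fun y => abs_nonneg y⟩
    exact hc.eventually h
  have hm : Measurable fun x : ℝ => C |x| := hl.measurable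
  rw [isTightMeasureSet_iff_exists_isCompact_measure_compl_le]
  intro ε hε
  have hC : Tendsto (fun x : ℝ => C |x|) (cocompact ℝ) atTop := by
    obtain ⟨c, hc, h⟩ := hA3 1 one_pos
    refine tendsto_atTop_mono' _ ?_ (Real.tendsto_log_atTop.comp hA5_inf)
    have : ∀ᶠ x : ℝ in cocompact ℝ, c ≤ ‖x‖ :=
      tendsto_norm_cocompact_atTop.eventually_ge_atTop c
    filter_upwards [this] with x hx
    simpa using h x hx
  obtain ⟨M, hM0, hM⟩ : ∃ M : ℝ, 0 < M ∧ ENNReal.ofReal A / ENNReal.ofReal M ≤ ε := by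
    have : Tendsto (fun M : ℝ => ENNReal.ofReal A / ENNReal.ofReal M) atTop (𝓝 (ENNReal.ofReal A / ⊤)) :=
      ENNReal.Tendsto.const_div ENNReal.tendsto_ofReal_atTop (by simp)
    rw [ENNReal.div_top] at this
    obtain ⟨M, h, h'⟩ := ((this.eventually_le_const hε).and (eventually_gt_atTop 0)).exists
    exact ⟨M, h', h⟩
  have hev := hC.eventually_ge_atTop M
  obtain ⟨K, hK, hKM⟩ := mem_cocompact.1 hev
  refine ⟨K, hK, ?_⟩
  rintro _ ⟨F, hF, rfl⟩
  refine le_trans ?_ hM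
  rw [ENNReal.le_div_iff_mul_le (by simp [hM0]) (by simp), mul_comm]
  refine le_trans ?_ hF
  refine le_trans ?_ (mul_meas_ge_le_lintegral₀ hm.ennreal_ofReal.aemeasurable (ENNReal.ofReal M))
  gcongr
  intro x hx
  exact ENNReal.ofReal_le_ofReal (hKM hx)

lemma entropy_usc (hf : Continuous f) (hp : Continuous pN) (h0 : ∀ y, 0 ≤ pN y)
    (h1 : ∀ y, pN y ≤ 1) {C : ℝ → ℝ} {A : ℝ}
    (htail : ∀ ε : ENNReal, 0 < ε → ∃ R : ℝ, 0 < R ∧ ∀ F : ProbabilityMeasure ℝ, F ∈ PA C A →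
      ∫⁻ y, {y : ℝ | R < |y|}.indicator
        (fun y => ENNReal.ofReal (negMulLog (outputDensity pN f F y))) y ≤ ε) :
    UpperSemicontinuousOn (fun F : ProbabilityMeasure ℝ =>
      ∫⁻ y, ENNReal.ofReal (negMulLog (outputDensity pN f F y))) (PA C A) := by
  intro F hF t ht
  obtain ⟨tmid, ht1, htmid⟩ := exists_between ht
  obtain ⟨s, hs1, hs2⟩ := exists_between ht1
  have htop : tmid ≠ ⊤ := ne_top_of_lt htmid
  obtain ⟨R, hR, hRF⟩ := htail (tmid - s) (tsub_pos_of_lt hs2)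
  set S : Set ℝ := {y : ℝ | R < |y|} with hS
  have mS : MeasurableSet S := measurableSet_lt measurable_const (by fun_prop)
  have mg : ∀ G : ProbabilityMeasure ℝ,
      Measurable fun y => ENNReal.ofReal (negMulLog (outputDensity pN f G y)) := fun G =>
    (ENNReal.continuous_ofReal.comp (continuous_negMulLog.comp
      (od_continuous hf hp h0 h1 G))).measurable
  have hsplit : ∀ G : ProbabilityMeasure ℝ,
      ∫⁻ y, ENNReal.ofReal (negMulLog (outputDensity pN f G y)) =
      (∫⁻ y, S.indicator (fun y => ENNReal.ofReal (negMulLog (outputDensity pN f G y))) y) +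
      ∫⁻ y in Sᶜ, ENNReal.ofReal (negMulLog (outputDensity pN f G y)) := by
    intro G
    rw [lintegral_indicator mS, lintegral_add_compl _ mS]
  have hvol : volume Sᶜ < ⊤ := by
    have : Sᶜ ⊆ Set.Icc (-R) R := by
      intro y hy
      simp only [hS, Set.mem_compl_iff, Set.mem_ofPred_eq, not_lt] at hy
      exact abs_le.1 hy
    exact (measure_mono this).trans_lt (by simp)
  have hlim : Tendsto (fun G : ProbabilityMeasure ℝ =>
      ∫⁻ y in Sᶜ, ENNReal.ofReal (negMulLog (outputDensity pN f G y))) (𝓝 F)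
      (𝓝 (∫⁻ y in Sᶜ, ENNReal.ofReal (negMulLog (outputDensity pN f F y)))) := by
    refine tendsto_lintegral_filter_of_dominated_convergence (fun _ => 1) ?_ ?_ ?_ ?_
    · exact Eventually.of_forall fun G => mg G
    · refine Eventually.of_forall fun G => ae_of_all _ fun y => ?_
      rw [← ENNReal.ofReal_one]
      apply ENNReal.ofReal_le_ofReal
      have := negMulLog_le_one_sub_self (od_nonneg (f := f) h0 (G : Measure ℝ) y)
      linarith [od_nonneg (f := f) h0 (G : Measure ℝ) y]
    · simpa using hvol.ne
    · refine ae_of_all _ fun y => ?_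
      refine (ENNReal.continuous_ofReal.tendsto _).comp ((continuous_negMulLog.tendsto _).comp ?_)
      have := (ProbabilityMeasure.tendsto_iff_forall_integral_tendsto (μs := id) (F := 𝓝 F)).1
        tendsto_id (BoundedContinuousFunction.ofNormedAddCommGroup (fun x => pN (y - f x))
          (by fun_prop) 1 fun x => by rw [Real.norm_of_nonneg (h0 _)]; exact h1 _)
      exact this
  have hlt : ∫⁻ y in Sᶜ, ENNReal.ofReal (negMulLog (outputDensity pN f F y)) < s :=
    (setLIntegral_le_lintegral _ _).trans_lt hs1
  filter_upwards [nhdsWithin_le_nhds (hlim.eventually_lt_const hlt), self_mem_nhdsWithin] with G hG hGP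
  show ∫⁻ y, ENNReal.ofReal (negMulLog (outputDensity pN f G y)) < t
  rw [hsplit]
  calc _ ≤ (tmid - s) + ∫⁻ y in Sᶜ, ENNReal.ofReal (negMulLog (outputDensity pN f G y)) := by
        gcongr; exact hRF G hGP
    _ < (tmid - s) + s :=
        ENNReal.add_lt_add_left (ne_top_of_le_ne_top htop tsub_le_self) hG
    _ = tmid := tsub_add_cancel_of_le hs2.le
    _ < t := htmid

end aux2
/-- Under assumptions A1–A8, if the map `F ↦ p(·;F)` from input
distributions to output densities is injective on `P_A`, then the maximizer of the
mutual information over `P_A` is unique. -/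
theorem capacity_maximizer_unique
    (f pN C : ℝ → ℝ) (A : ℝ) (hA : 0 < A)
    -- A1: the cost function is lower semi-continuous
    (hA1 : LowerSemicontinuousOn C (Set.Ici 0))
    -- A2: the cost function is non-decreasing (and WLOG non-negative with `C 0 = 0`)
    (hA2_mono : MonotoneOn C (Set.Ici 0)) (hA2_nonneg : ∀ x : ℝ, 0 ≤ x → 0 ≤ C x)
    (hC0 : C 0 = 0)
    -- A3: `C(|x|) = ω(ln |f(x)|)`
    (hA3 : ∀ κ : ℝ, 0 < κ → ∃ c : ℝ, 0 < c ∧ ∀ x : ℝ, c ≤ |x| → κ * Real.log |f x| ≤ C |x|)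
    -- A4: `f` is continuous
    (hA4 : Continuous f)
    -- A5: `|f(x)|` is non-decreasing in `|x|` and `|f(x)| → ∞` as `|x| → ∞`
    (hA5_mono : ∀ x z : ℝ, |x| ≤ |z| → |f x| ≤ |f z|)
    (hA5_inf : Tendsto (fun x : ℝ => |f x|) (cocompact ℝ) atTop)
    -- A6, A7: the noise density is continuous and (WLOG) bounded by one
    (hpN : IsPDF pN) (hA6 : Continuous pN) (hA7 : ∀ n : ℝ, pN n ≤ 1)
    -- A8: finite super-logarithmic noise moment
    (CN : ℝ → ℝ) (hCN_mono : MonotoneOn CN (Set.Ici 0))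
    (hCN_nonneg : ∀ x : ℝ, 0 ≤ x → 0 ≤ CN x) (hCN_super : SuperLog CN)
    (hCN_mom : ∫⁻ n, ENNReal.ofReal (CN |n| * pN n) < ⊤)
    -- injectivity of the output density map on `P_A`
    (hinj : Set.InjOn (fun F : ProbabilityMeasure ℝ =>
      (fun y => outputDensity pN f (F : Measure ℝ) y)) (PA C A)) :
    ∃! Fstar : ProbabilityMeasure ℝ, Fstar ∈ PA C A ∧ ∀ F ∈ PA C A,
      mutualInfo pN f (F : Measure ℝ) ≤ mutualInfo pN f (Fstar : Measure ℝ) := by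
  obtain ⟨-, h0, hint⟩ := hpN
  have hmom := log_moment hA6 h0 hint hCN_nonneg hCN_super hCN_mom
  have htail : ∀ ε : ENNReal, 0 < ε → ∃ R : ℝ, 0 < R ∧ ∀ F : ProbabilityMeasure ℝ, F ∈ PA C A →
      ∫⁻ y, {y : ℝ | R < |y|}.indicator
        (fun y => ENNReal.ofReal (negMulLog (outputDensity pN f F y))) y ≤ ε := fun ε hε =>
    entropy_tail hA4 hA6 h0 hA7 hint hA3 hA5_mono hmom hε
  have hcont : ∀ F : ProbabilityMeasure ℝ, Continuous (outputDensity pN f F) := fun F =>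
    od_continuous hA4 hA6 h0 hA7 F
  have hη0 : ∀ (F : ProbabilityMeasure ℝ) y, 0 ≤ negMulLog (outputDensity pN f F y) := fun F y =>
    negMulLog_nonneg (od_nonneg h0 _ _) (od_le_one hA4 hA6 h0 hA7 _ _)
  -- finiteness of the output entropy
  have hfin : ∀ F ∈ PA C A, ∫⁻ y, ENNReal.ofReal (negMulLog (outputDensity pN f F y)) < ⊤ := by
    intro F hF
    obtain ⟨R, hR, hRF⟩ := htail 1 one_pos
    have mS : MeasurableSet {y : ℝ | R < |y|} := measurableSet_lt measurable_const (by fun_prop)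
    rw [← lintegral_add_compl _ mS, ← lintegral_indicator mS]
    refine ENNReal.add_lt_top.2 ⟨(hRF F hF).trans_lt (by simp), ?_⟩
    have hvol : volume {y : ℝ | R < |y|}ᶜ < ⊤ := by
      have : {y : ℝ | R < |y|}ᶜ ⊆ Set.Icc (-R) R := by
        intro y hy
        simp only [Set.mem_compl_iff, Set.mem_ofPred_eq, not_lt] at hy
        exact abs_le.1 hy
      exact (measure_mono this).trans_lt (by simp)
    calc _ ≤ ∫⁻ y in {y : ℝ | R < |y|}ᶜ, 1 := by
          refine lintegral_mono fun y => ?_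
          rw [← ENNReal.ofReal_one]
          apply ENNReal.ofReal_le_ofReal
          have := negMulLog_le_one_sub_self (od_nonneg (f := f) h0 (F : Measure ℝ) y)
          linarith [od_nonneg (f := f) h0 (F : Measure ℝ) y]
      _ < ⊤ := by simpa using hvol
  have hInt : ∀ F ∈ PA C A, Integrable fun y => negMulLog (outputDensity pN f F y) := by
    intro F hF
    refine ⟨(continuous_negMulLog.comp (hcont F)).aestronglyMeasurable, ?_⟩
    rw [hasFiniteIntegral_iff_ofReal (ae_of_all _ (hη0 F))]
    exact hfin F hF
  -- the point mass at zero
  have hδ : (⟨Measure.dirac 0, Measure.dirac.isProbabilityMeasure⟩ : ProbabilityMeasure ℝ) ∈ PA C A := by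
    show ∫⁻ x, ENNReal.ofReal (C |x|) ∂(Measure.dirac (0:ℝ)) ≤ ENNReal.ofReal A
    rw [lintegral_dirac]
    simp [hC0]
  have hN : Integrable fun y => negMulLog (pN y) := by
    have h := (hInt _ hδ).comp_add_right (f 0)
    refine h.congr (ae_of_all _ fun y => ?_)
    show negMulLog (∫ x, pN (y + f 0 - f x) ∂(Measure.dirac (0:ℝ))) = _
    rw [integral_dirac]; simp
  have hMI : ∀ F ∈ PA C A, mutualInfo pN f (F : Measure ℝ) =
      (∫ y, negMulLog (outputDensity pN f F y)) - ∫ y, negMulLog (pN y) := fun F hF =>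
    mutualInfo_eq hA4 hA6 h0 hA7 F (hInt F hF) hN
  -- existence
  have hcpt : IsCompact (PA C A) := by
    have := isCompact_closure_of_isTightMeasureSet (PA_tight (A := A) hA1 hA3 hA5_inf)
    rwa [(PA_isClosed hA1 hA2_nonneg).closure_eq] at this
  obtain ⟨Fs, hFs, hmax⟩ := UpperSemicontinuousOn.exists_isMaxOn
    (Set.nonempty_of_mem hδ : (PA C A).Nonempty) hcpt
    (entropy_usc hA4 hA6 h0 hA7 htail)
  have hFsmax : ∀ F ∈ PA C A, mutualInfo pN f (F : Measure ℝ) ≤ mutualInfo pN f (Fs : Measure ℝ) := by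
    intro F hF
    rw [hMI F hF, hMI Fs hFs]
    refine sub_le_sub_right ?_ _
    rw [integral_eq_lintegral_of_nonneg_ae (ae_of_all _ (hη0 F)) (hInt F hF).aestronglyMeasurable,
      integral_eq_lintegral_of_nonneg_ae (ae_of_all _ (hη0 Fs)) (hInt Fs hFs).aestronglyMeasurable]
    exact ENNReal.toReal_mono (hfin Fs hFs).ne (hmax hF)
  refine ⟨Fs, ⟨hFs, hFsmax⟩, ?_⟩
  rintro G ⟨hG, hGmax⟩
  have heq : (∫ y, negMulLog (outputDensity pN f G y)) =
      ∫ y, negMulLog (outputDensity pN f Fs y) := by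
    have := le_antisymm (hFsmax G hG) (hGmax Fs hFs)
    rw [hMI G hG, hMI Fs hFs] at this
    linarith
  -- the midpoint
  set c : ENNReal := 2⁻¹ with hc
  have hcc : c + c = 1 := ENNReal.inv_two_add_inv_two
  let M : Measure ℝ := c • (G : Measure ℝ) + c • (Fs : Measure ℝ)
  have hMp : IsProbabilityMeasure M := ⟨by simp [M, hcc]⟩
  have hMPA : (⟨M, hMp⟩ : ProbabilityMeasure ℝ) ∈ PA C A := by
    show ∫⁻ x, ENNReal.ofReal (C |x|) ∂M ≤ ENNReal.ofReal A
    simp only [M]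
    rw [lintegral_add_measure, lintegral_smul_measure, lintegral_smul_measure]
    calc _ ≤ c • ENNReal.ofReal A + c • ENNReal.ofReal A := by
          simp only [smul_eq_mul]
          gcongr
          · exact hG
          · exact hFs
      _ = ENNReal.ofReal A := by rw [← add_smul, hcc, one_smul]
  have hMod : ∀ y, outputDensity pN f M y =
      (1/2 : ℝ) • outputDensity pN f G y + (1/2 : ℝ) • outputDensity pN f Fs y := by
    intro y
    simp only [M, outputDensity]
    have hct : c ≠ ⊤ := by simp [hc]
    rw [integral_add_measure ((od_integrable hA4 hA6 h0 hA7 G y).smul_measure hct)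
      ((od_integrable hA4 hA6 h0 hA7 Fs y).smul_measure hct), integral_smul_measure,
      integral_smul_measure]
    simp [hc]
  have hle := hFsmax _ hMPA
  rw [hMI _ hMPA, hMI Fs hFs] at hle
  have hle' : (∫ y, negMulLog (outputDensity pN f M y)) ≤
      ∫ y, negMulLog (outputDensity pN f Fs y) := by
    have : (∫ y, negMulLog (outputDensity pN f M y)) - (∫ y, negMulLog (pN y)) ≤
      (∫ y, negMulLog (outputDensity pN f Fs y)) - ∫ y, negMulLog (pN y) := hle
    linarith
  let d : ℝ → ℝ := fun y => negMulLog (outputDensity pN f M y) -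
    ((1/2 : ℝ) * negMulLog (outputDensity pN f G y) +
      (1/2 : ℝ) * negMulLog (outputDensity pN f Fs y))
  have hd0 : 0 ≤ d := by
    intro y
    have := concaveOn_negMulLog.2 (Set.mem_Ici.2 (od_nonneg (f := f) h0 (G : Measure ℝ) y))
      (Set.mem_Ici.2 (od_nonneg (f := f) h0 (Fs : Measure ℝ) y))
      (by norm_num : (0:ℝ) ≤ 1/2) (by norm_num : (0:ℝ) ≤ 1/2) (by norm_num)
    rw [← hMod] at this
    simp only [smul_eq_mul] at this
    simp only [d, Pi.zero_apply]; linarith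
  have hiM : Integrable fun y => negMulLog (outputDensity pN f M y) := hInt _ hMPA
  have hiS : Integrable fun y => (1/2 : ℝ) * negMulLog (outputDensity pN f G y) +
      (1/2 : ℝ) * negMulLog (outputDensity pN f Fs y) :=
    ((hInt G hG).const_mul _).add ((hInt Fs hFs).const_mul _)
  have hid : Integrable d := hiM.sub hiS
  have hd : ∫ y, d y = 0 := by
    refine le_antisymm ?_ (integral_nonneg hd0)
    simp only [d]
    rw [integral_sub hiM hiS, integral_add ((hInt G hG).const_mul _) ((hInt Fs hFs).const_mul _),
      integral_const_mul, integral_const_mul, heq]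
    linarith
  have hdz := (integral_eq_zero_iff_of_nonneg hd0 hid).1 hd
  have hpe : outputDensity pN f (G : Measure ℝ) =ᵐ[volume] outputDensity pN f (Fs : Measure ℝ) := by
    filter_upwards [hdz] with y hy
    by_contra hne
    have := strictConcaveOn_negMulLog.2 (Set.mem_Ici.2 (od_nonneg (f := f) h0 (G : Measure ℝ) y))
      (Set.mem_Ici.2 (od_nonneg (f := f) h0 (Fs : Measure ℝ) y)) hne
      (by norm_num : (0:ℝ) < 1/2) (by norm_num : (0:ℝ) < 1/2) (by norm_num)
    rw [← hMod] at this
    simp only [smul_eq_mul] at this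
    simp only [d, Pi.zero_apply] at hy
    linarith
  exact hinj hG hFs ((Continuous.ae_eq_iff_eq volume (hcont G) (hcont Fs)).1 hpe)
end

section
/- Consider the channel Y = f(X) + N and suppose assumptions A2 through A8 hold, with cost function C satisfying C(|x|) = ω(ln|f(x)|) and cost bound A > 0. Then the mutual information I is weakly continuous on P_A: if {F_m} ⊆ P_A converges weakly to F ∈ P_A, then I(F_m) → I(F). -/
open MeasureTheory Real Filter Topology

-- quick instance/elaboration checks

/-- A generalized dominated convergence theorem. -/
theorem aux_pratt (u g : ℕ → ℝ → ℝ) (u0 g0 : ℝ → ℝ)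
    (hum : ∀ n, Integrable (u n)) (hgm : ∀ n, Integrable (g n)) (hg0 : Integrable g0)
    (hu : ∀ n y, 0 ≤ u n y) (hug : ∀ n y, u n y ≤ g n y) (hu0g0 : ∀ y, u0 y ≤ g0 y)
    (hulim : ∀ y, Tendsto (fun n => u n y) atTop (𝓝 (u0 y)))
    (hglim : ∀ y, Tendsto (fun n => g n y) atTop (𝓝 (g0 y)))
    (hint : Tendsto (fun n => ∫ y, g n y) atTop (𝓝 (∫ y, g0 y))) :
    Tendsto (fun n => ∫ y, u n y) atTop (𝓝 (∫ y, u0 y)) := by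
  have hg0n : ∀ y, 0 ≤ g0 y := fun y =>
    ge_of_tendsto' (hglim y) (fun n => (hu n y).trans (hug n y))
  have hv : Tendsto (fun n => ∫ y, min (u n y) (g0 y)) atTop (𝓝 (∫ y, u0 y)) := by
    refine tendsto_integral_of_dominated_convergence g0
      (fun n => ((hum n).inf hg0).aestronglyMeasurable) hg0 ?_ ?_
    · intro n
      refine ae_of_all _ fun y => ?_
      rw [Real.norm_eq_abs, abs_of_nonneg (le_min (hu n y) (hg0n y))]
      exact min_le_right _ _
    · refine ae_of_all _ fun y => ?_
      have := (hulim y).min (tendsto_const_nhds (x := g0 y))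
      rwa [min_eq_left (hu0g0 y)] at this
  have hw : Tendsto (fun n => ∫ y, min (g n y) (g0 y)) atTop (𝓝 (∫ y, g0 y)) := by
    refine tendsto_integral_of_dominated_convergence g0
      (fun n => ((hgm n).inf hg0).aestronglyMeasurable) hg0 ?_ ?_
    · intro n
      refine ae_of_all _ fun y => ?_
      rw [Real.norm_eq_abs, abs_of_nonneg (le_min ((hu n y).trans (hug n y)) (hg0n y))]
      exact min_le_right _ _
    · refine ae_of_all _ fun y => ?_
      have := (hglim y).min (tendsto_const_nhds (x := g0 y))
      rwa [min_self] at this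
  have hup : Tendsto (fun n => (∫ y, min (u n y) (g0 y)) +
      ((∫ y, g n y) - ∫ y, min (g n y) (g0 y))) atTop (𝓝 (∫ y, u0 y)) := by
    have := hv.add (hint.sub hw)
    simpa using this
  refine tendsto_of_tendsto_of_tendsto_of_le_of_le hv hup ?_ ?_
  · intro n
    exact integral_mono ((hum n).inf hg0) (hum n) (fun y => min_le_left _ _)
  · intro n
    have h1 : Integrable (fun y => min (u n y) (g0 y)) := (hum n).inf hg0
    have h2 : Integrable (fun y => min (g n y) (g0 y)) := (hgm n).inf hg0
    have h3 : (∫ y, min (u n y) (g0 y)) + ((∫ y, g n y) - ∫ y, min (g n y) (g0 y))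
        = ∫ y, (min (u n y) (g0 y) + (g n y - min (g n y) (g0 y))) := by
      have h4 : Integrable (fun y => g n y - min (g n y) (g0 y)) := (hgm n).sub h2
      rw [integral_add h1 h4, integral_sub (hgm n) h2]
    show (∫ y, u n y) ≤ (∫ y, min (u n y) (g0 y)) + ((∫ y, g n y) - ∫ y, min (g n y) (g0 y))
    rw [h3]
    refine integral_mono (hum n) (h1.add ((hgm n).sub h2)) (fun y => ?_)
    have := hug n y
    show u n y ≤ min (u n y) (g0 y) + (g n y - min (g n y) (g0 y))
    rcases le_total (u n y) (g0 y) with h | h <;> rcases le_total (g n y) (g0 y) with h' | h' <;>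
      simp [h, h'] <;> linarith

theorem aux_tail (C : ℝ → ℝ) (A : ℝ) (hA : 0 < A) (G : ℝ → ℝ) (hG : Continuous G)
    (hG0 : ∀ x, 0 ≤ G x) (ε K : ℝ) (hε : 0 < ε) (hC : ∀ x : ℝ, 0 ≤ C |x|)
    (hb : ∀ x, G x ≤ K + ε * C |x|)
    (F : ProbabilityMeasure ℝ) (hF : F ∈ PA C A) :
    Integrable G (F : Measure ℝ) ∧
      (∫ x, G x ∂(F : Measure ℝ)) ≤ (∫ x, min (G x) K ∂(F : Measure ℝ)) + ε * A := by
  have hle : ∫⁻ x, ENNReal.ofReal (G x - min (G x) K) ∂(F : Measure ℝ)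
      ≤ ENNReal.ofReal (ε * A) := by
    calc ∫⁻ x, ENNReal.ofReal (G x - min (G x) K) ∂(F : Measure ℝ)
        ≤ ∫⁻ x, ENNReal.ofReal ε * ENNReal.ofReal (C |x|) ∂(F : Measure ℝ) := by
          refine lintegral_mono fun x => ?_
          rw [← ENNReal.ofReal_mul hε.le]
          refine ENNReal.ofReal_le_ofReal ?_
          have := hb x
          have := mul_nonneg hε.le (hC x)
          rcases le_total (G x) K with h | h <;> simp [h] <;> linarith
      _ = ENNReal.ofReal ε * ∫⁻ x, ENNReal.ofReal (C |x|) ∂(F : Measure ℝ) :=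
          lintegral_const_mul' _ _ ENNReal.ofReal_ne_top
      _ ≤ ENNReal.ofReal ε * ENNReal.ofReal A := by gcongr; exact hF
      _ = ENNReal.ofReal (ε * A) := (ENNReal.ofReal_mul hε.le).symm
  have hc1 : Continuous fun x => min (G x) K := hG.min continuous_const
  have hn : ∀ x, 0 ≤ G x - min (G x) K := fun x => sub_nonneg.2 (min_le_left _ _)
  have h1 : Integrable (fun x => G x - min (G x) K) (F : Measure ℝ) := by
    refine ⟨(hG.sub hc1).aestronglyMeasurable, ?_⟩
    rw [hasFiniteIntegral_iff_ofReal (ae_of_all _ hn)]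
    exact hle.trans_lt ENNReal.ofReal_lt_top
  have h2 : Integrable (fun x => min (G x) K) (F : Measure ℝ) := by
    refine Integrable.of_bound hc1.aestronglyMeasurable |K| (ae_of_all _ fun x => ?_)
    rw [Real.norm_eq_abs]
    have := hG0 x
    rcases le_total (G x) K with h | h
    · rw [min_eq_left h, abs_of_nonneg this]; exact h.trans (le_abs_self K)
    · rw [min_eq_right h]
  have h3 : Integrable G (F : Measure ℝ) := by
    have := h1.add h2
    refine this.congr (ae_of_all _ fun x => ?_)
    simp
  refine ⟨h3, ?_⟩
  have h4 : ∫ x, (G x - min (G x) K) ∂(F : Measure ℝ) ≤ ε * A := by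
    rw [integral_eq_lintegral_of_nonneg_ae (ae_of_all _ hn) h1.aestronglyMeasurable]
    exact ENNReal.toReal_le_of_le_ofReal (by positivity) hle
  rw [integral_sub h3 h2] at h4
  linarith

theorem aux_moment (C : ℝ → ℝ) (A : ℝ) (hA : 0 < A) (G : ℝ → ℝ) (hG : Continuous G)
    (hG0 : ∀ x, 0 ≤ G x) (hC : ∀ x : ℝ, 0 ≤ C |x|)
    (hb : ∀ ε : ℝ, 0 < ε → ∃ K : ℝ, ∀ x, G x ≤ K + ε * C |x|)
    (Fm : ℕ → ProbabilityMeasure ℝ) (F : ProbabilityMeasure ℝ)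
    (hFm : ∀ m : ℕ, Fm m ∈ PA C A) (hF : F ∈ PA C A)
    (hconv : Tendsto Fm atTop (𝓝 F)) :
    Tendsto (fun m => ∫ x, G x ∂(Fm m : Measure ℝ)) atTop (𝓝 (∫ x, G x ∂(F : Measure ℝ))) := by
  rw [Metric.tendsto_atTop]
  intro δ hδ
  obtain ⟨K, hK⟩ := hb (δ / (3 * A)) (by positivity)
  have hεA : δ / (3 * A) * A = δ / 3 := by field_simp
  have hc1 : Continuous fun x => min (G x) K := hG.min continuous_const
  have hbd : ∀ x, ‖min (G x) K‖ ≤ |K| := by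
    intro x
    rw [Real.norm_eq_abs]
    have := hG0 x
    rcases le_total (G x) K with h | h
    · rw [min_eq_left h, abs_of_nonneg this]; exact h.trans (le_abs_self K)
    · rw [min_eq_right h]
  have hlim := (ProbabilityMeasure.tendsto_iff_forall_integral_tendsto.1 hconv)
    (BoundedContinuousFunction.ofNormedAddCommGroup _ hc1 |K| hbd)
  simp only [BoundedContinuousFunction.coe_ofNormedAddCommGroup] at hlim
  rw [Metric.tendsto_atTop] at hlim
  obtain ⟨N, hN⟩ := hlim (δ / 3) (by positivity)
  refine ⟨N, fun m hm => ?_⟩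
  have key : ∀ P : ProbabilityMeasure ℝ, P ∈ PA C A →
      (∫ x, min (G x) K ∂(P : Measure ℝ)) ≤ ∫ x, G x ∂(P : Measure ℝ) ∧
      (∫ x, G x ∂(P : Measure ℝ)) ≤ (∫ x, min (G x) K ∂(P : Measure ℝ)) + δ / 3 := by
    intro P hP
    obtain ⟨hi, hle⟩ := aux_tail C A hA G hG hG0 _ K (by positivity) hC hK P hP
    rw [hεA] at hle
    refine ⟨integral_mono ?_ hi (fun x => min_le_left _ _), hle⟩
    exact Integrable.of_bound hc1.aestronglyMeasurable |K| (ae_of_all _ hbd)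
  have h1 := key _ (hFm m)
  have h2 := key _ hF
  have h3 := hN m hm
  rw [Real.dist_eq, abs_lt] at h3 ⊢
  constructor <;> linarith [h1.1, h1.2, h2.1, h2.2, h3.1, h3.2]

theorem aux_L_nonneg (y : ℝ) : 0 ≤ Real.log (1 + y ^ 2) :=
  Real.log_nonneg (by nlinarith [sq_nonneg y])

theorem aux_L_cont : Continuous fun y : ℝ => Real.log (1 + y ^ 2) :=
  Continuous.log (by fun_prop) (fun y => by positivity)

theorem aux_L_add (a n : ℝ) :
    Real.log (1 + (a + n) ^ 2) ≤ Real.log 2 + Real.log (1 + a ^ 2) + Real.log (1 + n ^ 2) := by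
  rw [← Real.log_mul (by norm_num) (by positivity), ← Real.log_mul (by positivity) (by positivity)]
  refine Real.log_le_log (by positivity) ?_
  nlinarith [sq_nonneg (a - n), mul_nonneg (sq_nonneg a) (sq_nonneg n)]

theorem aux_L_mono (a b : ℝ) (h : |a| ≤ |b|) :
    Real.log (1 + a ^ 2) ≤ Real.log (1 + b ^ 2) := by
  refine Real.log_le_log (by positivity) ?_
  linarith [sq_le_sq.2 h]

theorem aux_L_large (a : ℝ) (h : 1 ≤ |a|) :
    Real.log (1 + a ^ 2) ≤ Real.log 2 + 2 * Real.log |a| := by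
  have h0 : (0 : ℝ) < |a| := by linarith
  have : Real.log 2 + 2 * Real.log |a| = Real.log (2 * |a| ^ 2) := by
    rw [Real.log_mul (by norm_num) (by positivity), Real.log_pow]; norm_num
  rw [this]
  refine Real.log_le_log (by positivity) ?_
  rw [← sq_abs a]
  nlinarith

/-- Gibbs-type pointwise bound. -/
theorem aux_gibbs (p y : ℝ) (hp : 0 ≤ p) :
    Real.negMulLog p ≤ p * Real.log (1 + y ^ 2) + (1 + y ^ 2)⁻¹ := by
  have hq : (0 : ℝ) < 1 + y ^ 2 := by positivity
  rcases hp.eq_or_lt with rfl | hp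
  · simp; positivity
  have h := Real.log_le_sub_one_of_pos (x := (1 + y ^ 2)⁻¹ / p) (by positivity)
  rw [Real.log_div (by positivity) hp.ne', Real.log_inv] at h
  have h2 := mul_le_mul_of_nonneg_left h hp.le
  have h3 : p * ((1 + y ^ 2)⁻¹ / p - 1) = (1 + y ^ 2)⁻¹ - p := by field_simp
  rw [h3] at h2
  unfold Real.negMulLog
  linarith

theorem aux_noise_moment (pN : ℝ → ℝ) (hpN : IsPDF pN) (hi : Integrable pN)
    (CN : ℝ → ℝ)
    (hCN_nonneg : ∀ x : ℝ, 0 ≤ x → 0 ≤ CN x) (hCN_super : SuperLog CN)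
    (hCN_mom : ∫⁻ n, ENNReal.ofReal (CN |n| * pN n) < ⊤) :
    Integrable (fun n => pN n * Real.log (1 + n ^ 2)) := by
  obtain ⟨c, hc, hcb⟩ := hCN_super 2 (by norm_num)
  obtain ⟨hm, h0, h1⟩ := hpN
  set R := max c 1
  set K := Real.log 2 + Real.log (1 + R ^ 2)
  have hR : 1 ≤ R := le_max_right _ _
  have hl2 : 0 ≤ Real.log 2 := Real.log_nonneg (by norm_num)
  have hK0 : 0 ≤ K := add_nonneg hl2 (aux_L_nonneg R)
  have hb : ∀ n, Real.log (1 + n ^ 2) ≤ K + CN |n| := by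
    intro n
    have hCn := hCN_nonneg |n| (abs_nonneg n)
    rcases le_total |n| R with h | h
    · have := aux_L_mono n R (h.trans (le_abs_self R))
      simp only [K]; linarith
    · have h2 := aux_L_large n (hR.trans h)
      have h3 := hcb |n| ((le_max_left _ _).trans h)
      have := aux_L_nonneg R
      simp only [K]; linarith
  have hnn : ∀ n, 0 ≤ pN n * Real.log (1 + n ^ 2) := fun n => mul_nonneg (h0 n) (aux_L_nonneg n)
  refine ⟨(hm.mul aux_L_cont.measurable).aestronglyMeasurable, ?_⟩
  rw [hasFiniteIntegral_iff_ofReal (ae_of_all _ hnn)]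
  have hKi : Integrable (fun n => K * pN n) := hi.const_mul K
  calc ∫⁻ n, ENNReal.ofReal (pN n * Real.log (1 + n ^ 2))
      ≤ ∫⁻ n, (ENNReal.ofReal (K * pN n) + ENNReal.ofReal (CN |n| * pN n)) := by
        refine lintegral_mono fun n => ?_
        rw [← ENNReal.ofReal_add (mul_nonneg hK0 (h0 n))
          (mul_nonneg (hCN_nonneg _ (abs_nonneg n)) (h0 n))]
        refine ENNReal.ofReal_le_ofReal ?_
        have := mul_le_mul_of_nonneg_left (hb n) (h0 n)
        linarith
    _ = (∫⁻ n, ENNReal.ofReal (K * pN n)) + ∫⁻ n, ENNReal.ofReal (CN |n| * pN n) :=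
        lintegral_add_left (hm.const_mul K).ennreal_ofReal _
    _ < ⊤ := by
        refine ENNReal.add_lt_top.2 ⟨?_, hCN_mom⟩
        have := hKi.hasFiniteIntegral
        rwa [hasFiniteIntegral_iff_ofReal (ae_of_all _ fun n => mul_nonneg hK0 (h0 n))] at this

/-- Integrability of the (shifted) log moment. -/
theorem aux_shift_int (pN : ℝ → ℝ) (h0 : ∀ n, 0 ≤ pN n) (hcont : Continuous pN)
    (hi : Integrable pN) (hL : Integrable (fun n => pN n * Real.log (1 + n ^ 2))) (a : ℝ) :
    Integrable (fun n => pN n * Real.log (1 + (a + n) ^ 2)) := by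
  refine Integrable.mono' (g := fun n => (Real.log 2 + Real.log (1 + a ^ 2)) * pN n +
    pN n * Real.log (1 + n ^ 2)) ((hi.const_mul _).add hL) ?_ (ae_of_all _ fun n => ?_)
  · exact (hcont.mul (aux_L_cont.comp (by fun_prop))).aestronglyMeasurable
  · rw [Real.norm_eq_abs, abs_of_nonneg (mul_nonneg (h0 n) (aux_L_nonneg _))]
    have := mul_le_mul_of_nonneg_left (aux_L_add a n) (h0 n)
    linarith

theorem aux_shift_cont (pN : ℝ → ℝ) (h0 : ∀ n, 0 ≤ pN n) (hcont : Continuous pN)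
    (hi : Integrable pN) (hL : Integrable (fun n => pN n * Real.log (1 + n ^ 2))) :
    Continuous (fun a => ∫ n, pN n * Real.log (1 + (a + n) ^ 2)) := by
  rw [continuous_iff_continuousAt]
  intro a
  refine continuousAt_of_dominated (bound := fun n =>
    (Real.log 2 + Real.log (1 + (|a| + 1) ^ 2)) * pN n + pN n * Real.log (1 + n ^ 2)) ?_ ?_
    ((hi.const_mul _).add hL) ?_
  · exact Eventually.of_forall fun b =>
      (aux_shift_int pN h0 hcont hi hL b).aestronglyMeasurable
  · filter_upwards [Metric.ball_mem_nhds a one_pos] with b hb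
    refine ae_of_all _ fun n => ?_
    rw [Real.norm_eq_abs, abs_of_nonneg (mul_nonneg (h0 n) (aux_L_nonneg _))]
    have h1 : |b| ≤ |(|a| + 1)| := by
      rw [Metric.mem_ball, Real.dist_eq] at hb
      have := abs_sub_abs_le_abs_sub b a
      rw [abs_of_nonneg (a := |a| + 1) (by positivity)]
      linarith
    have h2 := aux_L_mono _ _ h1
    have h3 := mul_le_mul_of_nonneg_left
      ((aux_L_add b n).trans (add_le_add_left (add_le_add_right h2 _) _)) (h0 n)
    linarith
  · refine ae_of_all _ fun n => ?_
    exact (continuous_const.mul (aux_L_cont.comp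
      (continuous_id.add continuous_const))).continuousAt

/-- Basic facts on the joint density. -/
theorem aux_joint_int (pN f : ℝ → ℝ) (hf : Continuous f) (h0 : ∀ n, 0 ≤ pN n)
    (hcont : Continuous pN) (φ : ℝ → ℝ) (hφ : Measurable φ)
    (F : Measure ℝ) [IsProbabilityMeasure F] (hi : Integrable (fun n => pN n * φ (pN n))) :
    Integrable (fun z : ℝ × ℝ => pN (z.2 - f z.1) * φ (pN (z.2 - f z.1))) (F.prod volume) ∧
    (∫ z : ℝ × ℝ, pN (z.2 - f z.1) * φ (pN (z.2 - f z.1)) ∂(F.prod volume))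
      = ∫ n, pN n * φ (pN n) := by
  have hm : Measurable (fun z : ℝ × ℝ => pN (z.2 - f z.1) * φ (pN (z.2 - f z.1))) := by
    have h1 : Measurable (fun z : ℝ × ℝ => pN (z.2 - f z.1)) :=
      (show Continuous (fun z : ℝ × ℝ => pN (z.2 - f z.1)) by fun_prop).measurable
    exact h1.mul (hφ.comp h1)
  have hI : Integrable (fun z : ℝ × ℝ => pN (z.2 - f z.1) * φ (pN (z.2 - f z.1)))
      (F.prod volume) := by
    rw [integrable_prod_iff hm.aestronglyMeasurable]
    refine ⟨ae_of_all _ fun x => hi.comp_sub_right (f x), ?_⟩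
    have : ∀ x, ∫ y, ‖pN (y - f x) * φ (pN (y - f x))‖ = ∫ n, ‖pN n * φ (pN n)‖ := fun x =>
      integral_sub_right_eq_self (fun n => ‖pN n * φ (pN n)‖) (f x)
    simp only [this]
    exact integrable_const _
  refine ⟨hI, ?_⟩
  rw [integral_prod _ hI]
  have : ∀ x, ∫ y, pN (y - f x) * φ (pN (y - f x)) = ∫ n, pN n * φ (pN n) := fun x =>
    integral_sub_right_eq_self (fun n => pN n * φ (pN n)) (f x)
  simp [this]

theorem aux_out_nonneg (pN f : ℝ → ℝ) (h0 : ∀ n, 0 ≤ pN n) (F : Measure ℝ) (y : ℝ) :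
    0 ≤ outputDensity pN f F y := integral_nonneg fun x => h0 _

theorem aux_pN_int (pN f : ℝ → ℝ) (hf : Continuous f) (h0 : ∀ n, 0 ≤ pN n)
    (hcont : Continuous pN) (h1 : ∀ n, pN n ≤ 1)
    (F : Measure ℝ) [IsProbabilityMeasure F] (y : ℝ) :
    Integrable (fun x => pN (y - f x)) F := by
  refine Integrable.of_bound
    (show Continuous (fun x => pN (y - f x)) by fun_prop).aestronglyMeasurable 1
    (ae_of_all _ fun x => ?_)
  rw [Real.norm_eq_abs, abs_of_nonneg (h0 _)]
  exact h1 _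

theorem aux_out_le (pN f : ℝ → ℝ) (hf : Continuous f) (h0 : ∀ n, 0 ≤ pN n)
    (hcont : Continuous pN) (h1 : ∀ n, pN n ≤ 1)
    (F : Measure ℝ) [IsProbabilityMeasure F] (y : ℝ) :
    outputDensity pN f F y ≤ 1 := by
  have := integral_mono (aux_pN_int pN f hf h0 hcont h1 F y) (integrable_const (1 : ℝ))
    (fun x => h1 _)
  simpa [outputDensity] using this

theorem aux_out_meas (pN f : ℝ → ℝ) (hf : Continuous f) (hcont : Continuous pN)
    (F : Measure ℝ) [IsProbabilityMeasure F] :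
    Measurable (outputDensity pN f F) := by
  have : StronglyMeasurable (fun z : ℝ × ℝ => pN (z.1 - f z.2)) :=
    (show Continuous (fun z : ℝ × ℝ => pN (z.1 - f z.2)) by fun_prop).stronglyMeasurable
  exact (this.integral_prod_right (ν := F)).measurable

theorem aux_joint_swap (pN f : ℝ → ℝ) (ψ : ℝ → ℝ)
    (F : Measure ℝ) [IsProbabilityMeasure F]
    (hi : Integrable (fun z : ℝ × ℝ => pN (z.2 - f z.1) * ψ z.2) (F.prod volume)) :
    Integrable (fun y => outputDensity pN f F y * ψ y) ∧
    (∫ z : ℝ × ℝ, pN (z.2 - f z.1) * ψ z.2 ∂(F.prod volume))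
      = ∫ y, outputDensity pN f F y * ψ y := by
  have h := hi.integral_prod_right
  have h2 := integral_prod_symm _ hi
  simp only [integral_mul_const] at h h2
  exact ⟨h, h2⟩

theorem aux_joint_of (pN f : ℝ → ℝ) (hf : Continuous f) (h0 : ∀ n, 0 ≤ pN n)
    (hcont : Continuous pN) (h1 : ∀ n, pN n ≤ 1) (ψ : ℝ → ℝ) (hψ : Measurable ψ)
    (F : Measure ℝ) [IsProbabilityMeasure F]
    (hi : Integrable (fun y => outputDensity pN f F y * ψ y)) :
    Integrable (fun z : ℝ × ℝ => pN (z.2 - f z.1) * ψ z.2) (F.prod volume) := by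
  have hm : Measurable (fun z : ℝ × ℝ => pN (z.2 - f z.1) * ψ z.2) :=
    (show Continuous (fun z : ℝ × ℝ => pN (z.2 - f z.1)) by fun_prop).measurable.mul
      (hψ.comp measurable_snd)
  rw [integrable_prod_iff' hm.aestronglyMeasurable]
  refine ⟨ae_of_all _ fun y => (aux_pN_int pN f hf h0 hcont h1 F y).mul_const (ψ y), ?_⟩
  refine hi.norm.congr (ae_of_all _ fun y => ?_)
  simp only [norm_mul, integral_mul_const]
  congr 1
  rw [Real.norm_eq_abs, abs_of_nonneg (aux_out_nonneg pN f h0 F y)]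
  unfold outputDensity
  refine integral_congr_ae (ae_of_all _ fun x => ?_)
  simp only [Real.norm_eq_abs]
  rw [abs_of_nonneg (h0 _)]

/-- The log-moment of the output. -/
theorem aux_log_moment (pN f : ℝ → ℝ) (hf : Continuous f) (h0 : ∀ n, 0 ≤ pN n)
    (hcont : Continuous pN)
    (hi : Integrable pN) (hL : Integrable (fun n => pN n * Real.log (1 + n ^ 2)))
    (F : Measure ℝ) [IsProbabilityMeasure F]
    (hG : Integrable (fun x => ∫ n, pN n * Real.log (1 + (f x + n) ^ 2)) F) :
    Integrable (fun y => outputDensity pN f F y * Real.log (1 + y ^ 2)) ∧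
    (∫ y, outputDensity pN f F y * Real.log (1 + y ^ 2)) =
      ∫ x, (∫ n, pN n * Real.log (1 + (f x + n) ^ 2)) ∂F := by
  have hsh : ∀ x, ∫ y, pN (y - f x) * Real.log (1 + y ^ 2) =
      ∫ n, pN n * Real.log (1 + (f x + n) ^ 2) := by
    intro x
    rw [← integral_sub_right_eq_self (fun n => pN n * Real.log (1 + (f x + n) ^ 2)) (f x)]
    simp
  have hm : Measurable (fun z : ℝ × ℝ => pN (z.2 - f z.1) * Real.log (1 + z.2 ^ 2)) :=
    (show Continuous (fun z : ℝ × ℝ => pN (z.2 - f z.1)) by fun_prop).measurable.mul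
      (aux_L_cont.measurable.comp measurable_snd)
  have hJ : Integrable (fun z : ℝ × ℝ => pN (z.2 - f z.1) * Real.log (1 + z.2 ^ 2))
      (F.prod volume) := by
    rw [integrable_prod_iff hm.aestronglyMeasurable]
    refine ⟨ae_of_all _ fun x => ?_, ?_⟩
    · have := (aux_shift_int pN h0 hcont hi hL (f x)).comp_sub_right (f x)
      simpa using this
    · refine hG.congr (ae_of_all _ fun x => ?_)
      show (∫ n, pN n * Real.log (1 + (f x + n) ^ 2)) =
        ∫ y, ‖pN (y - f x) * Real.log (1 + y ^ 2)‖
      rw [← hsh x]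
      refine integral_congr_ae (ae_of_all _ fun y => ?_)
      simp only [Real.norm_eq_abs]
      rw [abs_of_nonneg (mul_nonneg (h0 _) (aux_L_nonneg y))]
  obtain ⟨ha, hb⟩ := aux_joint_swap pN f (fun y => Real.log (1 + y ^ 2)) F hJ
  refine ⟨ha, ?_⟩
  rw [← hb, integral_prod _ hJ]
  simp only [hsh]

theorem aux_negMulLog_int (p : ℝ → ℝ) (hp : Measurable p) (h0 : ∀ y, 0 ≤ p y)
    (h1 : ∀ y, p y ≤ 1) (hL : Integrable (fun y => p y * Real.log (1 + y ^ 2))) :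
    Integrable (fun y => Real.negMulLog (p y)) := by
  refine Integrable.mono' (hL.add integrable_inv_one_add_sq)
    (Real.continuous_negMulLog.measurable.comp hp).aestronglyMeasurable (ae_of_all _ fun y => ?_)
  rw [Real.norm_eq_abs, abs_of_nonneg (Real.negMulLog_nonneg (h0 y) (h1 y))]
  exact aux_gibbs (p y) y (h0 y)

/-- `I(F) = h(p_F) - h(p_N)`. -/
theorem aux_mutualInfo_eq (pN f : ℝ → ℝ) (hf : Continuous f) (h0 : ∀ n, 0 ≤ pN n)
    (hcont : Continuous pN) (h1 : ∀ n, pN n ≤ 1)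
    (hL : Integrable (fun n => pN n * Real.log (1 + n ^ 2)))
    (F : Measure ℝ) [IsProbabilityMeasure F]
    (hLF : Integrable (fun y => outputDensity pN f F y * Real.log (1 + y ^ 2))) :
    mutualInfo pN f F = (∫ n, pN n * Real.log (pN n)) +
      ∫ y, Real.negMulLog (outputDensity pN f F y) := by
  have hom := aux_out_meas pN f hf hcont F
  have ho0 := aux_out_nonneg pN f h0 F
  have ho1 := aux_out_le pN f hf h0 hcont h1 F
  have i1 : Integrable (fun n => pN n * Real.log (pN n)) := by
    have := (aux_negMulLog_int pN hcont.measurable h0 h1 hL).neg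
    refine this.congr (ae_of_all _ fun n => ?_)
    simp [Real.negMulLog]
  have i2' := aux_negMulLog_int _ hom ho0 ho1 hLF
  have i2 : Integrable (fun y => outputDensity pN f F y * Real.log (outputDensity pN f F y)) := by
    refine i2'.neg.congr (ae_of_all _ fun n => ?_)
    simp [Real.negMulLog]
  obtain ⟨j1, e1⟩ := aux_joint_int pN f hf h0 hcont Real.log Real.measurable_log F i1
  have j2 := aux_joint_of pN f hf h0 hcont h1 (fun y => Real.log (outputDensity pN f F y))
    (Real.measurable_log.comp hom) F i2
  have e2 := (aux_joint_swap pN f (fun y => Real.log (outputDensity pN f F y)) F j2).2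
  have hae : ∀ᵐ z : ℝ × ℝ ∂(F.prod volume),
      pN (z.2 - f z.1) * Real.log (pN (z.2 - f z.1) / outputDensity pN f F z.2) =
      pN (z.2 - f z.1) * Real.log (pN (z.2 - f z.1)) -
        pN (z.2 - f z.1) * Real.log (outputDensity pN f F z.2) := by
    have hmc : Measurable (fun z : ℝ × ℝ => pN (z.2 - f z.1)) :=
      (show Continuous (fun z : ℝ × ℝ => pN (z.2 - f z.1)) by fun_prop).measurable
    have hkey : ∀ᵐ z : ℝ × ℝ ∂(F.prod volume),
        outputDensity pN f F z.2 = 0 → pN (z.2 - f z.1) = 0 := by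
      -- the exceptional set has zero mass
      have hs : MeasurableSet {z : ℝ × ℝ | outputDensity pN f F z.2 = 0 ∧ pN (z.2 - f z.1) ≠ 0} :=
        ((hom.comp measurable_snd) (measurableSet_singleton 0)).inter
          (hmc (measurableSet_singleton 0)).compl
      have hz : (F.prod volume)
          {z : ℝ × ℝ | outputDensity pN f F z.2 = 0 ∧ pN (z.2 - f z.1) ≠ 0} = 0 := by
        rw [Measure.prod_apply_symm hs, lintegral_eq_zero_iff (measurable_measure_prodMk_right hs)]
        refine ae_of_all _ fun y => ?_
        show F {x | outputDensity pN f F y = 0 ∧ pN (y - f x) ≠ 0} = 0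
        by_cases hy : outputDensity pN f F y = 0
        · have := (integral_eq_zero_iff_of_nonneg (fun x => h0 (y - f x))
            (aux_pN_int pN f hf h0 hcont h1 F y)).1 hy
          simp only [hy, true_and]
          exact this
        · simp [hy]
      rw [ae_iff]
      convert hz using 2
      ext z
      simp
    filter_upwards [hkey] with z hz
    by_cases hp : pN (z.2 - f z.1) = 0
    · simp [hp]
    · rw [Real.log_div hp (fun h => hp (hz h))]
      ring
  have hJ : Integrable (fun z : ℝ × ℝ =>
      pN (z.2 - f z.1) * Real.log (pN (z.2 - f z.1) / outputDensity pN f F z.2))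
      (F.prod volume) :=
    (j1.sub j2).congr (hae.mono fun z hz => hz.symm)
  have := integral_prod _ hJ
  unfold mutualInfo
  rw [← this, integral_congr_ae hae, integral_sub j1 j2, e1, e2, sub_eq_add_neg, ← integral_neg]
  simp [Real.negMulLog]


/-- Under assumptions A2 through A8, the mutual information of
the channel `Y = f(X) + N` is weakly continuous on `P_A`: if `F_m ∈ P_A` converges
weakly to `F ∈ P_A` then `I(F_m) → I(F)`. -/
theorem mutualInfo_weakly_continuous
    (f pN C : ℝ → ℝ) (A : ℝ) (hA : 0 < A)
    -- A2: the cost function is non-decreasing and non-negative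
    (hA2_mono : MonotoneOn C (Set.Ici 0)) (hA2_nonneg : ∀ x : ℝ, 0 ≤ x → 0 ≤ C x)
    -- A3: `C(|x|) = ω(ln |f(x)|)`
    (hA3 : ∀ κ : ℝ, 0 < κ → ∃ c : ℝ, 0 < c ∧ ∀ x : ℝ, c ≤ |x| → κ * Real.log |f x| ≤ C |x|)
    -- A4: `f` is continuous
    (hA4 : Continuous f)
    -- A5: `|f(x)|` is non-decreasing in `|x|` and `|f(x)| → ∞` as `|x| → ∞`
    (hA5_mono : ∀ x z : ℝ, |x| ≤ |z| → |f x| ≤ |f z|)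
    (hA5_inf : Tendsto (fun x : ℝ => |f x|) (cocompact ℝ) atTop)
    -- A6, A7: the noise density is continuous and (WLOG) bounded by one
    (hpN : IsPDF pN) (hA6 : Continuous pN) (hA7 : ∀ n : ℝ, pN n ≤ 1)
    -- A8: finite super-logarithmic noise moment
    (CN : ℝ → ℝ) (hCN_mono : MonotoneOn CN (Set.Ici 0))
    (hCN_nonneg : ∀ x : ℝ, 0 ≤ x → 0 ≤ CN x) (hCN_super : SuperLog CN)
    (hCN_mom : ∫⁻ n, ENNReal.ofReal (CN |n| * pN n) < ⊤)
    -- a weakly convergent sequence in `P_A`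
    (Fm : ℕ → ProbabilityMeasure ℝ) (F : ProbabilityMeasure ℝ)
    (hFm : ∀ m : ℕ, Fm m ∈ PA C A) (hF : F ∈ PA C A)
    (hconv : Tendsto Fm atTop (𝓝 F)) :
    Tendsto (fun m => mutualInfo pN f (Fm m : Measure ℝ)) atTop
      (𝓝 (mutualInfo pN f (F : Measure ℝ))) := by
  obtain ⟨hm, h0, hone⟩ := hpN
  have hi : Integrable pN := by
    by_contra h
    rw [integral_undef h] at hone
    exact zero_ne_one hone
  have hL := aux_noise_moment pN ⟨hm, h0, hone⟩ hi CN hCN_nonneg hCN_super hCN_mom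
  have hC : ∀ x : ℝ, 0 ≤ C |x| := fun x => hA2_nonneg _ (abs_nonneg x)
  set G : ℝ → ℝ := fun x => ∫ n, pN n * Real.log (1 + (f x + n) ^ 2) with hGdef
  have hGc : Continuous G := (aux_shift_cont pN h0 hA6 hi hL).comp hA4
  have hG0 : ∀ x, 0 ≤ G x := fun x =>
    integral_nonneg fun n => mul_nonneg (h0 n) (aux_L_nonneg _)
  have hGle : ∀ x, G x ≤ (Real.log 2 + Real.log (1 + f x ^ 2)) +
      ∫ n, pN n * Real.log (1 + n ^ 2) := by
    intro x
    have : (Real.log 2 + Real.log (1 + f x ^ 2)) + ∫ n, pN n * Real.log (1 + n ^ 2)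
        = ∫ n, ((Real.log 2 + Real.log (1 + f x ^ 2)) * pN n + pN n * Real.log (1 + n ^ 2)) := by
      rw [integral_add (hi.const_mul _) hL, integral_const_mul, hone, mul_one]
    rw [this]
    refine integral_mono (aux_shift_int pN h0 hA6 hi hL (f x)) ((hi.const_mul _).add hL)
      (fun n => ?_)
    have := mul_le_mul_of_nonneg_left (aux_L_add (f x) n) (h0 n)
    show pN n * Real.log (1 + (f x + n) ^ 2) ≤
      (Real.log 2 + Real.log (1 + f x ^ 2)) * pN n + pN n * Real.log (1 + n ^ 2)
    linarith
  have hl2 : 0 ≤ Real.log 2 := Real.log_nonneg (by norm_num)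
  have hGb : ∀ ε : ℝ, 0 < ε → ∃ K : ℝ, ∀ x, G x ≤ K + ε * C |x| := by
    intro ε hε
    obtain ⟨c, hc, hcb⟩ := hA3 (2 / ε) (by positivity)
    refine ⟨Real.log 2 + (Real.log 2 + Real.log (1 + f c ^ 2)) +
      ∫ n, pN n * Real.log (1 + n ^ 2), fun x => ?_⟩
    have h1 := hGle x
    have h2 := aux_L_nonneg (f c)
    have h3 := mul_nonneg hε.le (hC x)
    have h4 : Real.log (1 + f x ^ 2) ≤ Real.log 2 + Real.log (1 + f c ^ 2) + ε * C |x| := by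
      rcases le_total |x| c with h | h
      · have := aux_L_mono _ _ (hA5_mono x c (h.trans (le_abs_self c)))
        linarith
      · rcases le_total |f x| 1 with h' | h'
        · have := aux_L_mono (f x) 1 (by simpa using h')
          norm_num at this
          linarith
        · have h5 := aux_L_large _ h'
          have h6 := mul_le_mul_of_nonneg_left (hcb x h) hε.le
          have h7 : ε * (2 / ε * Real.log |f x|) = 2 * Real.log |f x| := by field_simp
          linarith
    linarith
  have hGi : ∀ P : ProbabilityMeasure ℝ, P ∈ PA C A → Integrable G (P : Measure ℝ) := by
    intro P hP
    obtain ⟨K, hK⟩ := hGb 1 one_pos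
    exact (aux_tail C A hA G hGc hG0 1 K one_pos hC hK P hP).1
  have hLP : ∀ P : ProbabilityMeasure ℝ, P ∈ PA C A →
      Integrable (fun y => outputDensity pN f (P : Measure ℝ) y * Real.log (1 + y ^ 2)) ∧
      (∫ y, outputDensity pN f (P : Measure ℝ) y * Real.log (1 + y ^ 2)) =
        ∫ x, G x ∂(P : Measure ℝ) :=
    fun P hP => aux_log_moment pN f hA4 h0 hA6 hi hL _ (hGi P hP)
  have hmom := aux_moment C A hA G hGc hG0 hC hGb Fm F hFm hF hconv
  have hplim : ∀ y, Tendsto (fun m => outputDensity pN f (Fm m : Measure ℝ) y) atTop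
      (𝓝 (outputDensity pN f (F : Measure ℝ) y)) := by
    intro y
    have := (ProbabilityMeasure.tendsto_iff_forall_integral_tendsto.1 hconv)
      (BoundedContinuousFunction.ofNormedAddCommGroup (fun x => pN (y - f x))
        (by fun_prop) 1 (fun x => by
          rw [Real.norm_eq_abs, abs_of_nonneg (h0 _)]; exact hA7 _))
    simpa [outputDensity] using this
  have hEq : ∀ P : ProbabilityMeasure ℝ, P ∈ PA C A →
      mutualInfo pN f (P : Measure ℝ) = (∫ n, pN n * Real.log (pN n)) +
        ∫ y, Real.negMulLog (outputDensity pN f (P : Measure ℝ) y) :=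
    fun P hP => aux_mutualInfo_eq pN f hA4 h0 hA6 hA7 hL _ (hLP P hP).1
  rw [hEq F hF]
  simp only [hEq _ (hFm _)]
  refine tendsto_const_nhds.add ?_
  refine aux_pratt _ (fun m y => outputDensity pN f (Fm m : Measure ℝ) y * Real.log (1 + y ^ 2)
      + (1 + y ^ 2)⁻¹) _
    (fun y => outputDensity pN f (F : Measure ℝ) y * Real.log (1 + y ^ 2) + (1 + y ^ 2)⁻¹)
    ?_ ?_ ?_ ?_ ?_ ?_ ?_ ?_ ?_
  · intro m
    exact aux_negMulLog_int _ (aux_out_meas pN f hA4 hA6 _) (aux_out_nonneg pN f h0 _)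
      (aux_out_le pN f hA4 h0 hA6 hA7 _) (hLP _ (hFm m)).1
  · intro m
    exact (hLP _ (hFm m)).1.add integrable_inv_one_add_sq
  · exact (hLP _ hF).1.add integrable_inv_one_add_sq
  · intro m y
    exact Real.negMulLog_nonneg (aux_out_nonneg pN f h0 _ y) (aux_out_le pN f hA4 h0 hA6 hA7 _ y)
  · intro m y
    exact aux_gibbs _ y (aux_out_nonneg pN f h0 _ y)
  · intro y
    exact aux_gibbs _ y (aux_out_nonneg pN f h0 _ y)
  · intro y
    exact (Real.continuous_negMulLog.tendsto _).comp (hplim y)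
  · intro y
    exact ((hplim y).mul_const _).add_const _
  · rw [integral_add (hLP _ hF).1 integrable_inv_one_add_sq, (hLP _ hF).2]
    have : ∀ m, (∫ y, (outputDensity pN f (Fm m : Measure ℝ) y * Real.log (1 + y ^ 2)
        + (1 + y ^ 2)⁻¹)) = (∫ x, G x ∂(Fm m : Measure ℝ)) + ∫ y : ℝ, (1 + y ^ 2)⁻¹ := by
      intro m
      rw [integral_add (hLP _ (hFm m)).1 integrable_inv_one_add_sq, (hLP _ (hFm m)).2]
    simp only [this]
    exact hmom.add_const _
end
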